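/- Let γ > 1, c₀ > 0, and let n : [0,1] → ℝ be a positive smooth function with n''(t) > 0 on [0,1], n'(t) < 0 for t ∈ (0,1), n'(1) = 0, and n(1) = 1. Set b₁ = √(2c₀/(γ+1)), let b₀ ∈ (0, b₁) be the unique solution of b₀^{γ−1}(c₀ − ((γ−1)/2)b₀²) n(0)^{γ−1} = b₁^{γ+1}, and let φ_b : [0,1] → ℝ be the symmetric solution potential, i.e. φ_b'(x) = u(x) where u is the symmetric subsonic–sonic velocity (u(0) = b₀, u(1) = b₁, n(x)ρ(u(x))u(x) constant with ρ(s) = ((c₀ − ((γ−1)/2)s²)/γ)^{1/(γ−1)}, u' > 0). Suppose φ : [0,1] × ℝ → ℝ is a C² function, 2π-periodic in y, satisfying the potential flow equation n(x)²(c² − (∂₁φ)²)∂₁₁φ − 2∂₁φ ∂₂φ ∂₁₂φ + (c² − (∂₂φ)²/n(x)²)∂₂₂φ + n(x)n'(x)(c² + (∂₂φ)²/n(x)²)∂₁φ = 0 in (0,1) × ℝ, where c² = c₀ − ((γ−1)/2)((∂₁φ)² + (∂₂φ)²/n(x)²), together with: ∂₁φ ≥ 0 on {x=0} and {x=1}; (∂₁φ)²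 + (∂₂φ)²/n(0)² = b₀² on {x=0}; (∂₁φ)² + (∂₂φ)² = b₁² on {x=1}; and ∂₁₁φ > 0 on {x=1}. Then φ(x,y) = φ_b(x) + C for some constant C; in particular ∂₂φ ≡ 0 and ∂₁φ(x,y) = u(x). -/

import Mathlib

open Set

/-- The coordinate domain of the approximate nozzle: `[0,1] × ℝ` (periodic in `y`). -/
def nozzle : Set (ℝ × ℝ) := Set.Icc (0:ℝ) 1 ×ˢ (Set.univ : Set ℝ)

/-- `∂₁φ`, computed within the nozzle. -/
noncomputable def pd1 (φ : ℝ × ℝ → ℝ) (p : ℝ × ℝ) : ℝ :=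
  fderivWithin ℝ φ nozzle p (1, 0)

/-- `∂₂φ`, computed within the nozzle. -/
noncomputable def pd2 (φ : ℝ × ℝ → ℝ) (p : ℝ × ℝ) : ℝ :=
  fderivWithin ℝ φ nozzle p (0, 1)

/-- `∂₁₁φ`. -/
noncomputable def pd11 (φ : ℝ × ℝ → ℝ) (p : ℝ × ℝ) : ℝ :=
  fderivWithin ℝ (pd1 φ) nozzle p (1, 0)

/-- `∂₁₂φ`. -/
noncomputable def pd12 (φ : ℝ × ℝ → ℝ) (p : ℝ × ℝ) : ℝ :=
  fderivWithin ℝ (pd2 φ) nozzle p (1, 0)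

/-- `∂₂₂φ`. -/
noncomputable def pd22 (φ : ℝ × ℝ → ℝ) (p : ℝ × ℝ) : ℝ :=
  fderivWithin ℝ (pd2 φ) nozzle p (0, 1)

/-- The squared sound speed `c² = c₀ − ((γ−1)/2)((∂₁φ)² + (∂₂φ)²/n(x)²)` from Bernoulli's law. -/
noncomputable def soundSq (γ c₀ : ℝ) (n : ℝ → ℝ) (φ : ℝ × ℝ → ℝ) (p : ℝ × ℝ) : ℝ :=
  c₀ - (γ - 1) / 2 * ((pd1 φ p) ^ 2 + (pd2 φ p) ^ 2 / (n p.1) ^ 2)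

/-- The potential flow equation at the point `p`. -/
def PotentialFlowEq (γ c₀ : ℝ) (n : ℝ → ℝ) (φ : ℝ × ℝ → ℝ) (p : ℝ × ℝ) : Prop :=
  (n p.1) ^ 2 * (soundSq γ c₀ n φ p - (pd1 φ p) ^ 2) * pd11 φ p
    - 2 * pd1 φ p * pd2 φ p * pd12 φ p
    + (soundSq γ c₀ n φ p - (pd2 φ p) ^ 2 / (n p.1) ^ 2) * pd22 φ p
    + n p.1 * deriv n p.1 * (soundSq γ c₀ n φ p + (pd2 φ p) ^ 2 / (n p.1) ^ 2) * pd1 φ p = 0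

section PotentialFlow

open Filter Topology MeasureTheory
open scoped Pointwise

/-- `2π`-periodicity in the second variable. -/
def YPeriodic (f : ℝ × ℝ → ℝ) : Prop := ∀ x y : ℝ, f (x, y + 2 * Real.pi) = f (x, y)

theorem mem_nozzle {p : ℝ × ℝ} : p ∈ nozzle ↔ p.1 ∈ Icc (0:ℝ) 1 := by
  simp [nozzle]

theorem uniqueDiffOn_nozzle : UniqueDiffOn ℝ nozzle :=
  (uniqueDiffOn_Icc zero_lt_one).prod uniqueDiffOn_univ

theorem interior_nozzle : interior nozzle = Ioo (0:ℝ) 1 ×ˢ (univ : Set ℝ) := by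
  rw [nozzle, interior_prod_eq, interior_Icc, interior_univ]

theorem nozzle_eq_closure : nozzle = closure (Ioo (0:ℝ) 1 ×ˢ (univ : Set ℝ)) := by
  rw [closure_prod_eq, closure_Ioo (by norm_num), closure_univ, nozzle]

theorem mem_nozzle_of_mem_interior {p : ℝ × ℝ} (hp : p ∈ Ioo (0:ℝ) 1 ×ˢ (univ : Set ℝ)) :
    p ∈ nozzle := mem_nozzle.2 (Ioo_subset_Icc_self hp.1)

theorem nozzle_mem_nhds {p : ℝ × ℝ} (hp : p ∈ Ioo (0:ℝ) 1 ×ˢ (univ : Set ℝ)) :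
    nozzle ∈ 𝓝 p := by
  rw [← interior_nozzle] at hp
  exact mem_interior_iff_mem_nhds.1 hp

section Slices

variable {f : ℝ × ℝ → ℝ}

theorem hasDerivAt_slice_snd (hf : DifferentiableOn ℝ f nozzle) {x : ℝ} (hx : x ∈ Icc (0:ℝ) 1)
    (y : ℝ) : HasDerivAt (fun t => f (x, t)) (pd2 f (x, y)) y := by
  have h := (hf (x, y) (mem_nozzle.2 hx)).hasFDerivWithinAt
  have hg : HasDerivWithinAt (fun t : ℝ => (x, t)) ((0:ℝ), (1:ℝ)) univ y :=
    ((hasDerivAt_const y x).prodMk (hasDerivAt_id y)).hasDerivWithinAt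
  have := h.comp_hasDerivWithinAt y hg (fun t _ => mem_nozzle.2 hx)
  exact hasDerivWithinAt_univ.1 this

theorem hasDerivWithinAt_slice_fst (hf : DifferentiableOn ℝ f nozzle) {x : ℝ}
    (hx : x ∈ Icc (0:ℝ) 1) (y : ℝ) :
    HasDerivWithinAt (fun t => f (t, y)) (pd1 f (x, y)) (Icc 0 1) x := by
  have h := (hf (x, y) (mem_nozzle.2 hx)).hasFDerivWithinAt
  have hg : HasDerivWithinAt (fun t : ℝ => (t, y)) ((1:ℝ), (0:ℝ)) (Icc 0 1) x :=
    ((hasDerivAt_id x).prodMk (hasDerivAt_const x y)).hasDerivWithinAt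
  exact h.comp_hasDerivWithinAt x hg (fun t ht => mem_nozzle.2 ht)

theorem hasDerivAt_slice_fst (hf : DifferentiableOn ℝ f nozzle) {x : ℝ}
    (hx : x ∈ Ioo (0:ℝ) 1) (y : ℝ) :
    HasDerivAt (fun t => f (t, y)) (pd1 f (x, y)) x :=
  (hasDerivWithinAt_slice_fst hf (Ioo_subset_Icc_self hx) y).hasDerivAt
    (Icc_mem_nhds hx.1 hx.2)

theorem pd1_eq_of_hasDerivAt (hf : DifferentiableOn ℝ f nozzle) {x y d : ℝ}
    (hx : x ∈ Ioo (0:ℝ) 1) (h : HasDerivAt (fun t => f (t, y)) d x) : pd1 f (x, y) = d :=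
  (hasDerivAt_slice_fst hf hx y).unique h

theorem pd1_eq_of_hasDerivWithinAt (hf : DifferentiableOn ℝ f nozzle) {x y d : ℝ}
    (hx : x ∈ Icc (0:ℝ) 1) (h : HasDerivWithinAt (fun t => f (t, y)) d (Icc 0 1) x) :
    pd1 f (x, y) = d :=
  (uniqueDiffOn_Icc zero_lt_one x hx).eq_deriv _ (hasDerivWithinAt_slice_fst hf hx y) h

theorem pd2_eq_of_hasDerivAt (hf : DifferentiableOn ℝ f nozzle) {x y d : ℝ}
    (hx : x ∈ Icc (0:ℝ) 1) (h : HasDerivAt (fun t => f (x, t)) d y) : pd2 f (x, y) = d :=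
  (hasDerivAt_slice_snd hf hx y).unique h

theorem contDiffOn_pd1 {m : ℕ} (hf : ContDiffOn ℝ (m + 1 : ℕ) f nozzle) :
    ContDiffOn ℝ m (pd1 f) nozzle :=
  (hf.fderivWithin uniqueDiffOn_nozzle (m := m) (by norm_cast)).clm_apply contDiffOn_const

theorem contDiffOn_pd2 {m : ℕ} (hf : ContDiffOn ℝ (m + 1 : ℕ) f nozzle) :
    ContDiffOn ℝ m (pd2 f) nozzle :=
  (hf.fderivWithin uniqueDiffOn_nozzle (m := m) (by norm_cast)).clm_apply contDiffOn_const

theorem continuousOn_pd1 (hf : ContDiffOn ℝ 1 f nozzle) : ContinuousOn (pd1 f) nozzle :=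
  (contDiffOn_pd1 (m := 0) (by simpa using hf)).continuousOn

theorem continuousOn_pd2 (hf : ContDiffOn ℝ 1 f nozzle) : ContinuousOn (pd2 f) nozzle :=
  (contDiffOn_pd2 (m := 0) (by simpa using hf)).continuousOn

theorem contDiffOn_one_pd1 (hf : ContDiffOn ℝ 2 f nozzle) : ContDiffOn ℝ 1 (pd1 f) nozzle := by
  simpa using contDiffOn_pd1 (m := 1) (by simpa using hf)

theorem contDiffOn_one_pd2 (hf : ContDiffOn ℝ 2 f nozzle) : ContDiffOn ℝ 1 (pd2 f) nozzle := by
  simpa using contDiffOn_pd2 (m := 1) (by simpa using hf)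

theorem pd2_pd1_eq_pd12 (hf : ContDiffOn ℝ 2 f nozzle) {p : ℝ × ℝ} (hp : p ∈ nozzle) :
    pd2 (pd1 f) p = pd12 f p := by
  have hsymm : IsSymmSndFDerivWithinAt ℝ f nozzle p := by
    refine (hf p hp).isSymmSndFDerivWithinAt (by simp) uniqueDiffOn_nozzle ?_ hp
    rw [interior_nozzle, ← nozzle_eq_closure]
    exact hp
  have hd : DifferentiableWithinAt ℝ (fderivWithin ℝ f nozzle) nozzle p :=
    (hf.fderivWithin uniqueDiffOn_nozzle (m := 1) (by norm_num)).differentiableOn (by norm_num) p hp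
  have key : ∀ v w : ℝ × ℝ, fderivWithin ℝ (fun q => fderivWithin ℝ f nozzle q v) nozzle p w
      = fderivWithin ℝ (fderivWithin ℝ f nozzle) nozzle p w v := by
    intro v w
    have h := (hd.hasFDerivWithinAt.clm_apply (hasFDerivWithinAt_const v p nozzle)).fderivWithin
      (uniqueDiffOn_nozzle p hp)
    rw [h]
    simp
  unfold pd12
  rw [pd2]
  unfold pd1 pd2
  rw [key, key]
  exact hsymm _ _

theorem YPeriodic.fderivWithin_eq (hf : YPeriodic f) (x y : ℝ) :
    fderivWithin ℝ f nozzle (x, y + 2 * Real.pi) = fderivWithin ℝ f nozzle (x, y) := by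
  have hfe : (fun q : ℝ × ℝ => f (q + (0, 2 * Real.pi))) = f := by
    ext ⟨a, b⟩
    simpa using hf a b
  have hs : ((0:ℝ), 2 * Real.pi) +ᵥ nozzle = nozzle := by
    ext ⟨a, b⟩
    simp only [mem_vadd_set, mem_nozzle, vadd_eq_add]
    constructor
    · rintro ⟨⟨x, z⟩, h, he⟩
      rw [Prod.mk_add_mk, Prod.mk.injEq, zero_add] at he
      rwa [← he.1]
    · exact fun h => ⟨(a, b - 2 * Real.pi), h, by simp⟩
  have := fderivWithin_comp_add_right (𝕜 := ℝ) (f := f) (s := nozzle) (x := (x, y))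
    ((0:ℝ), 2 * Real.pi)
  rw [hfe, hs] at this
  simpa using this.symm

theorem YPeriodic.fst_deriv (hf : YPeriodic f) : YPeriodic (pd1 f) := fun x y => by
  simp only [pd1, hf.fderivWithin_eq]

theorem YPeriodic.snd_deriv (hf : YPeriodic f) : YPeriodic (pd2 f) := fun x y => by
  simp only [pd2, hf.fderivWithin_eq]

theorem YPeriodic.exists_mem_Icc (hf : YPeriodic f) (x y : ℝ) :
    ∃ z ∈ Icc 0 (2 * Real.pi), f (x, z) = f (x, y) := by
  have hper : Function.Periodic (fun t => f (x, t)) (2 * Real.pi) := fun t => hf x t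
  obtain ⟨z, hz, h⟩ := hper.exists_mem_Ico₀ Real.two_pi_pos y
  exact ⟨z, Ico_subset_Icc_self hz, h.symm⟩

theorem isCompact_cell : IsCompact (Icc (0:ℝ) 1 ×ˢ Icc (0:ℝ) (2 * Real.pi)) :=
  isCompact_Icc.prod isCompact_Icc

theorem cell_subset_nozzle : Icc (0:ℝ) 1 ×ˢ Icc (0:ℝ) (2 * Real.pi) ⊆ nozzle :=
  fun _ hp => mem_nozzle.2 hp.1

theorem YPeriodic.exists_bound (hf : YPeriodic f) (hc : ContinuousOn f nozzle) :
    ∃ K, 0 < K ∧ ∀ p ∈ nozzle, |f p| ≤ K := by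
  obtain ⟨K, hK⟩ := isCompact_cell.exists_bound_of_continuousOn (hc.mono cell_subset_nozzle)
  refine ⟨max K 1, by positivity, ?_⟩
  rintro ⟨x, y⟩ hp
  obtain ⟨z, hz, h⟩ := hf.exists_mem_Icc x y
  rw [← h]
  exact (hK (x, z) ⟨mem_nozzle.1 hp, hz⟩).trans (le_max_left _ _)

theorem YPeriodic.exists_isMinOn (hf : YPeriodic f) (hc : ContinuousOn f nozzle) :
    ∃ p ∈ nozzle, ∀ q ∈ nozzle, f p ≤ f q := by
  obtain ⟨p, hp, hmin⟩ := isCompact_cell.exists_isMinOn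
    ⟨((0:ℝ), (0:ℝ)), ⟨by simp, by simp [Real.pi_pos.le]⟩⟩ (hc.mono cell_subset_nozzle)
  refine ⟨p, cell_subset_nozzle hp, ?_⟩
  rintro ⟨x, y⟩ hq
  obtain ⟨z, hz, h⟩ := hf.exists_mem_Icc x y
  rw [← h]
  exact hmin (show (x, z) ∈ _ from ⟨mem_nozzle.1 hq, hz⟩)

theorem continuous_slice_snd (hf : ContinuousOn f nozzle) {x : ℝ} (hx : x ∈ Icc (0:ℝ) 1) :
    Continuous (fun y => f (x, y)) := by
  rw [← continuousOn_univ]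
  exact hf.comp (by fun_prop) (fun y _ => mem_nozzle.2 hx)

/-- A periodic function of `y` whose `y`-derivative is constant on a slice is constant there. -/
theorem YPeriodic.pd2_eq_zero_of_const (hf : YPeriodic f) (hd : DifferentiableOn ℝ f nozzle)
    {x c : ℝ} (hx : x ∈ Icc (0:ℝ) 1) (hc : ∀ y, pd2 f (x, y) = c) : c = 0 := by
  have hder := hasDerivAt_slice_snd hd hx
  obtain ⟨z, -, hz⟩ := exists_hasDerivAt_eq_slope (fun y => f (x, y)) (fun y => pd2 f (x, y))
    Real.two_pi_pos (fun y _ => (hder y).continuousAt.continuousWithinAt) (fun y _ => hder y)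
  have := hf x 0
  rw [zero_add] at this
  rw [hc, this] at hz
  simpa using hz

/-- Divergence theorem on a part of the nozzle, for fields periodic in `y`. -/
theorem integral_divergence_nozzle {P Q : ℝ × ℝ → ℝ} (hP : ContDiffOn ℝ 1 P nozzle)
    (hQ : ContDiffOn ℝ 1 Q nozzle) (hQper : YPeriodic Q) {a b : ℝ} (ha : 0 ≤ a) (hab : a ≤ b)
    (hb : b ≤ 1) :
    ∫ p in Icc (a, (0:ℝ)) (b, 2 * Real.pi), (pd1 P p + pd2 Q p) =
      (∫ y in (0:ℝ)..(2 * Real.pi), P (b, y)) - ∫ y in (0:ℝ)..(2 * Real.pi), P (a, y) := by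
  have hsub : Icc (a, (0:ℝ)) (b, 2 * Real.pi) ⊆ nozzle := fun p hp =>
    mem_nozzle.2 ⟨ha.trans hp.1.1, hp.2.1.trans hb⟩
  have hmem : ∀ p ∈ Ioo a b ×ˢ Ioo (0:ℝ) (2 * Real.pi), nozzle ∈ 𝓝 p := fun p hp =>
    nozzle_mem_nhds ⟨⟨ha.trans_lt hp.1.1, hp.1.2.trans_le hb⟩, mem_univ _⟩
  have key := integral_divergence_prod_Icc_of_hasFDerivAt_off_countable_of_le P Q
    (fderivWithin ℝ P nozzle) (fderivWithin ℝ Q nozzle) (a, 0) (b, 2 * Real.pi)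
    ⟨hab, Real.two_pi_pos.le⟩ ∅ countable_empty (hP.continuousOn.mono hsub)
    (hQ.continuousOn.mono hsub)
    (fun p hp => by
      have h := hmem p hp.1
      exact ((hP.differentiableOn (by norm_num)) p (mem_of_mem_nhds h)).hasFDerivWithinAt.hasFDerivAt h)
    (fun p hp => by
      have h := hmem p hp.1
      exact ((hQ.differentiableOn (by norm_num)) p (mem_of_mem_nhds h)).hasFDerivWithinAt.hasFDerivAt h)
    (((continuousOn_pd1 hP).add (continuousOn_pd2 hQ)).mono hsub |>.integrableOn_compact
      isCompact_Icc)
  have hQ0 : ∀ x, Q (x, 2 * Real.pi) = Q (x, 0) := fun x => by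
    simpa using hQper x 0
  simp only [hQ0, sub_self, zero_add] at key
  exact key

end Slices

/-- A periodic `C²` solution of the potential flow equation in the nozzle. -/
structure PeriodicFlow (γ c₀ : ℝ) (n : ℝ → ℝ) (φ : ℝ × ℝ → ℝ) : Prop where
  one_lt : 1 < γ
  pos : 0 < c₀
  smooth : ContDiff ℝ (⊤ : ℕ∞) n
  n_pos : ∀ t ∈ Icc (0:ℝ) 1, 0 < n t
  contDiffOn : ContDiffOn ℝ 2 φ nozzle
  periodic : YPeriodic φ
  eqn : ∀ p ∈ Ioo (0:ℝ) 1 ×ˢ (univ : Set ℝ), PotentialFlowEq γ c₀ n φ p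

/-- The squared speed of the flow with potential `φ`. -/
noncomputable def speedSq (n : ℝ → ℝ) (φ : ℝ × ℝ → ℝ) (p : ℝ × ℝ) : ℝ :=
  (pd1 φ p) ^ 2 + (pd2 φ p) ^ 2 / (n p.1) ^ 2

theorem soundSq_eq (γ c₀ : ℝ) (n : ℝ → ℝ) (φ : ℝ × ℝ → ℝ) (p : ℝ × ℝ) :
    soundSq γ c₀ n φ p = c₀ - (γ - 1) / 2 * speedSq n φ p := rfl

namespace PeriodicFlow

variable {γ c₀ : ℝ} {n : ℝ → ℝ} {φ : ℝ × ℝ → ℝ}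

theorem diff (F : PeriodicFlow γ c₀ n φ) : DifferentiableOn ℝ φ nozzle :=
  F.contDiffOn.differentiableOn (by norm_num)

theorem contDiffOn_fst (F : PeriodicFlow γ c₀ n φ) : ContDiffOn ℝ 1 (pd1 φ) nozzle :=
  contDiffOn_one_pd1 F.contDiffOn

theorem contDiffOn_snd (F : PeriodicFlow γ c₀ n φ) : ContDiffOn ℝ 1 (pd2 φ) nozzle :=
  contDiffOn_one_pd2 F.contDiffOn

theorem diff_fst (F : PeriodicFlow γ c₀ n φ) : DifferentiableOn ℝ (pd1 φ) nozzle :=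
  F.contDiffOn_fst.differentiableOn (by norm_num)

theorem diff_snd (F : PeriodicFlow γ c₀ n φ) : DifferentiableOn ℝ (pd2 φ) nozzle :=
  F.contDiffOn_snd.differentiableOn (by norm_num)

theorem continuousOn_pd11 (F : PeriodicFlow γ c₀ n φ) : ContinuousOn (pd11 φ) nozzle :=
  continuousOn_pd1 F.contDiffOn_fst

theorem continuousOn_pd12 (F : PeriodicFlow γ c₀ n φ) : ContinuousOn (pd12 φ) nozzle :=
  continuousOn_pd1 F.contDiffOn_snd

theorem continuousOn_pd22 (F : PeriodicFlow γ c₀ n φ) : ContinuousOn (pd22 φ) nozzle :=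
  continuousOn_pd2 F.contDiffOn_snd

theorem n_ne (F : PeriodicFlow γ c₀ n φ) {p : ℝ × ℝ} (hp : p ∈ nozzle) : n p.1 ≠ 0 :=
  (F.n_pos _ (mem_nozzle.1 hp)).ne'

theorem contDiff_n (F : PeriodicFlow γ c₀ n φ) : ContDiff ℝ 1 (fun p : ℝ × ℝ => n p.1) :=
  (F.smooth.of_le (by norm_cast)).comp contDiff_fst

theorem hasDerivAt_n (F : PeriodicFlow γ c₀ n φ) (x : ℝ) : HasDerivAt n (deriv n x) x :=
  (F.smooth.differentiable (by simp) x).hasDerivAt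

theorem continuous_deriv_n (F : PeriodicFlow γ c₀ n φ) : Continuous (deriv n) :=
  F.smooth.continuous_deriv (by norm_cast)

theorem contDiffOn_speedSq (F : PeriodicFlow γ c₀ n φ) :
    ContDiffOn ℝ 1 (speedSq n φ) nozzle :=
  (F.contDiffOn_fst.pow 2).add ((F.contDiffOn_snd.pow 2).div (F.contDiff_n.contDiffOn.pow 2)
    (fun _ hp => pow_ne_zero 2 (F.n_ne hp)))

theorem periodic_speedSq (F : PeriodicFlow γ c₀ n φ) : YPeriodic (speedSq n φ) := fun x y => by
  simp only [speedSq, F.periodic.fst_deriv x y, F.periodic.snd_deriv x y]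

theorem hasDerivAt_speedSq_snd (F : PeriodicFlow γ c₀ n φ) {x : ℝ} (hx : x ∈ Icc (0:ℝ) 1)
    (y : ℝ) : HasDerivAt (fun t => speedSq n φ (x, t))
      (2 * (pd1 φ (x, y) * pd12 φ (x, y) + pd2 φ (x, y) * pd22 φ (x, y) / n x ^ 2)) y := by
  have h1 := hasDerivAt_slice_snd F.diff_fst hx y
  rw [pd2_pd1_eq_pd12 F.contDiffOn (mem_nozzle.2 hx)] at h1
  have h2 : HasDerivAt (fun t => pd2 φ (x, t)) (pd22 φ (x, y)) y :=
    hasDerivAt_slice_snd F.diff_snd hx y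
  refine ((h1.pow 2).add ((h2.pow 2).div_const (n x ^ 2))).congr_deriv ?_
  simp
  ring

theorem hasDerivAt_speedSq_fst (F : PeriodicFlow γ c₀ n φ) {x : ℝ} (hx : x ∈ Ioo (0:ℝ) 1)
    (y : ℝ) : HasDerivAt (fun t => speedSq n φ (t, y))
      (2 * (pd1 φ (x, y) * pd11 φ (x, y) + pd2 φ (x, y) * pd12 φ (x, y) / n x ^ 2
        - pd2 φ (x, y) ^ 2 * deriv n x / n x ^ 3)) x := by
  have h1 : HasDerivAt (fun t => pd1 φ (t, y)) (pd11 φ (x, y)) x :=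
    hasDerivAt_slice_fst F.diff_fst hx y
  have h2 : HasDerivAt (fun t => pd2 φ (t, y)) (pd12 φ (x, y)) x :=
    hasDerivAt_slice_fst F.diff_snd hx y
  have hn : n x ≠ 0 := (F.n_pos x (Ioo_subset_Icc_self hx)).ne'
  refine ((h1.pow 2).add ((h2.pow 2).div ((F.hasDerivAt_n x).pow 2)
    (pow_ne_zero 2 hn))).congr_deriv ?_
  simp
  field_simp
  ring

theorem continuousOn_soundSq (F : PeriodicFlow γ c₀ n φ) :
    ContinuousOn (soundSq γ c₀ n φ) nozzle :=
  continuousOn_const.sub (continuousOn_const.mul F.contDiffOn_speedSq.continuousOn)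

theorem eqn_nozzle (F : PeriodicFlow γ c₀ n φ) : ∀ p ∈ nozzle, PotentialFlowEq γ c₀ n φ p := by
  have hα := F.contDiffOn_fst.continuousOn
  have hβ := F.contDiffOn_snd.continuousOn
  have hn : ContinuousOn (fun p : ℝ × ℝ => n p.1) nozzle := F.contDiff_n.continuous.continuousOn
  have hn' : ContinuousOn (fun p : ℝ × ℝ => deriv n p.1) nozzle :=
    (F.continuous_deriv_n.comp continuous_fst).continuousOn
  have hb : ContinuousOn (fun p : ℝ × ℝ => pd2 φ p ^ 2 / n p.1 ^ 2) nozzle :=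
    (hβ.pow 2).div (hn.pow 2) (fun _ hp => pow_ne_zero 2 (F.n_ne hp))
  have hz := F.continuousOn_soundSq
  have h11 := F.continuousOn_pd11
  have h12 := F.continuousOn_pd12
  have h22 := F.continuousOn_pd22
  refine Set.EqOn.of_subset_closure (t := nozzle) F.eqn ?_ continuousOn_const
    (fun _ => mem_nozzle_of_mem_interior) nozzle_eq_closure.le
  exact (((((hn.pow 2).mul (hz.sub (hα.pow 2))).mul h11).sub
    (((continuousOn_const.mul hα).mul hβ).mul h12)).add ((hz.sub hb).mul h22)).add
    (((hn.mul hn').mul (hz.add hb)).mul hα)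

/-- At a sonic exit with accelerating flow the velocity is normal to the exit. -/
theorem exit_normal (F : PeriodicFlow γ c₀ n φ) (hn1 : n 1 = 1) (hn'1 : deriv n 1 = 0) {b₁ : ℝ}
    (hb₁ : 0 < b₁) (hsonic : c₀ - (γ - 1) / 2 * b₁ ^ 2 = b₁ ^ 2)
    (hout : ∀ y : ℝ, 0 ≤ pd1 φ (1, y))
    (hexit : ∀ y : ℝ, (pd1 φ (1, y)) ^ 2 + (pd2 φ (1, y)) ^ 2 = b₁ ^ 2)
    (hacc : ∀ y : ℝ, 0 < pd11 φ (1, y)) (y : ℝ) :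
    pd2 φ (1, y) = 0 ∧ pd1 φ (1, y) = b₁ := by
  have h1 : (1:ℝ) ∈ Icc (0:ℝ) 1 := by simp
  have hd1 : ∀ y, HasDerivAt (fun t => pd1 φ (1, t)) (pd12 φ (1, y)) y := fun y => by
    rw [← pd2_pd1_eq_pd12 F.contDiffOn (mem_nozzle.2 h1)]
    exact hasDerivAt_slice_snd F.diff_fst h1 y
  have hd2 : ∀ y, HasDerivAt (fun t => pd2 φ (1, t)) (pd22 φ (1, y)) y :=
    hasDerivAt_slice_snd F.diff_snd h1
  have htan : ∀ y, pd1 φ (1, y) * pd12 φ (1, y) + pd2 φ (1, y) * pd22 φ (1, y) = 0 := by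
    intro y
    have h := ((hd1 y).pow 2).add ((hd2 y).pow 2)
    have he : (fun t => pd1 φ (1, t)) ^ 2 + (fun t => pd2 φ (1, t)) ^ 2 = fun _ => b₁ ^ 2 :=
      funext hexit
    rw [he] at h
    have := h.unique (hasDerivAt_const y _)
    simp at this
    linarith
  have hneg : ∀ y, pd22 φ (1, y) ≤ 0 := by
    intro y
    have heq := F.eqn_nozzle (1, y) (mem_nozzle.2 h1)
    have hs : soundSq γ c₀ n φ (1, y) = b₁ ^ 2 := by
      have := hexit y
      simp only [soundSq, hn1, one_pow, div_one, this, hsonic]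
    simp only [PotentialFlowEq, hs, hn1, hn'1] at heq
    have h2 : pd2 φ (1, y) ^ 2 * pd11 φ (1, y)
        + (pd1 φ (1, y) ^ 2 + 2 * pd2 φ (1, y) ^ 2) * pd22 φ (1, y) = 0 := by
      rw [← hexit y] at heq
      linear_combination heq + 2 * pd2 φ (1, y) * htan y
    by_contra! hc
    have : 0 < (pd1 φ (1, y) ^ 2 + 2 * pd2 φ (1, y) ^ 2) * pd22 φ (1, y) := by
      apply mul_pos _ hc
      nlinarith [hexit y, sq_nonneg (pd2 φ (1, y))]
    nlinarith [mul_nonneg (sq_nonneg (pd2 φ (1, y))) (hacc y).le]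
  have hanti : Antitone (fun t => pd2 φ (1, t)) :=
    antitone_of_hasDerivAt_nonpos hd2 hneg
  have hconst : ∀ t, pd2 φ (1, t) = pd2 φ (1, 0) := by
    intro t
    have hper : Function.Periodic (fun t => pd2 φ (1, t)) (2 * Real.pi) :=
      fun t => F.periodic.snd_deriv 1 t
    obtain ⟨s, hs, hst⟩ := hper.exists_mem_Ico₀ Real.two_pi_pos t
    have e1 : pd2 φ (1, s) ≤ pd2 φ (1, 0) := hanti hs.1
    have e2 : pd2 φ (1, 2 * Real.pi) ≤ pd2 φ (1, s) := hanti hs.2.le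
    have e3 := F.periodic.snd_deriv 1 0
    rw [zero_add] at e3
    have hst' : pd2 φ (1, t) = pd2 φ (1, s) := hst
    linarith
  have h0 : ∀ y, pd2 φ (1, y) = 0 := fun y => by
    rw [hconst y]
    exact F.periodic.pd2_eq_zero_of_const F.diff h1 hconst
  refine ⟨h0 y, ?_⟩
  have := hexit y
  rw [h0 y] at this
  exact (pow_left_inj₀ (hout y) hb₁.le two_ne_zero).1 (by simpa using this)

/-- The flow does not reach cavitation if it does not do so at the entry and the exit. -/
theorem soundSq_pos (F : PeriodicFlow γ c₀ n φ) {z₀ : ℝ} (hz₀ : 0 < z₀)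
    (h0 : ∀ y, z₀ ≤ soundSq γ c₀ n φ (0, y)) (h1 : ∀ y, z₀ ≤ soundSq γ c₀ n φ (1, y))
    {p : ℝ × ℝ} (hp : p ∈ nozzle) : 0 < soundSq γ c₀ n φ p := by
  have hγ := F.one_lt
  have hc := F.pos
  have hn : ContinuousOn (fun p : ℝ × ℝ => n p.1) nozzle := F.contDiff_n.continuous.continuousOn
  have hn' : ContinuousOn (fun p : ℝ × ℝ => deriv n p.1) nozzle :=
    (F.continuous_deriv_n.comp continuous_fst).continuousOn
  set a : ℝ × ℝ → ℝ := fun p =>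
    -(γ - 1) * (pd11 φ p + pd22 φ p / n p.1 ^ 2 + deriv n p.1 / n p.1 * pd1 φ p) with ha
  have hac : ContinuousOn a nozzle :=
    continuousOn_const.mul ((F.continuousOn_pd11.add (F.continuousOn_pd22.div (hn.pow 2)
      (fun _ hp => pow_ne_zero 2 (F.n_ne hp)))).add ((hn'.div hn (fun p hp => F.n_ne hp)).mul
      F.contDiffOn_fst.continuousOn))
  have hap : YPeriodic a := fun x y => by
    have e1 : pd11 φ (x, y + 2 * Real.pi) = pd11 φ (x, y) := F.periodic.fst_deriv.fst_deriv x y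
    have e2 : pd22 φ (x, y + 2 * Real.pi) = pd22 φ (x, y) := F.periodic.snd_deriv.snd_deriv x y
    simp only [ha, e1, e2, F.periodic.fst_deriv x y]
  obtain ⟨A, hA, hAb⟩ := hap.exists_bound hac
  obtain ⟨K, hK, hKb⟩ := F.periodic.exists_bound F.contDiffOn.continuousOn
  set δ := c₀ / (γ - 1) with hδ
  have hδpos : 0 < δ := div_pos hc (by linarith)
  set Λ := (A + 1) / δ with hΛ
  have hΛpos : 0 < Λ := by positivity
  have hΛδ : Λ * δ = A + 1 := by rw [hΛ]; field_simp
  set m := min z₀ (c₀ / 2) with hm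
  have hmpos : 0 < m := lt_min hz₀ (by linarith)
  set ε := m * Real.exp (-(Λ * K)) with hε
  have hεpos : 0 < ε := by positivity
  have hεE : ∀ q ∈ nozzle, ε * Real.exp (Λ * φ q) ≤ m := by
    intro q hq
    rw [hε, mul_assoc, ← Real.exp_add]
    have : Real.exp (-(Λ * K) + Λ * φ q) ≤ 1 := by
      rw [Real.exp_le_one_iff]
      nlinarith [(abs_le.1 (hKb q hq)).2]
    nlinarith
  set z := soundSq γ c₀ n φ with hz
  set Ψ : ℝ × ℝ → ℝ := fun q => Real.exp (Λ * φ q) * (z q - ε * Real.exp (Λ * φ q)) with hΨ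
  have hφc := F.contDiffOn.continuousOn
  have hzc : ContinuousOn z nozzle := F.continuousOn_soundSq
  have hΨc : ContinuousOn Ψ nozzle := by fun_prop
  have hΨp : YPeriodic Ψ := fun x y => by
    simp only [hΨ, hz, soundSq_eq, F.periodic x y, F.periodic_speedSq x y]
  by_contra! hneg
  obtain ⟨⟨x, y⟩, hmem, hmin⟩ := hΨp.exists_isMinOn hΨc
  have hE : ∀ q, 0 < Real.exp (Λ * φ q) := fun q => Real.exp_pos _
  have hΨneg : Ψ (x, y) < 0 := by
    refine (hmin p hp).trans_lt ?_
    exact mul_neg_of_pos_of_neg (hE p) (by nlinarith [hE p])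
  have hzlt : z (x, y) < ε * Real.exp (Λ * φ (x, y)) := by
    by_contra! h
    have := mul_nonneg (hE (x, y)).le (sub_nonneg.2 h)
    exact absurd hΨneg (not_lt.2 this)
  have hzm : z (x, y) < m := hzlt.trans_le (hεE _ hmem)
  have hx : x ∈ Ioo (0:ℝ) 1 := by
    have hx := mem_nozzle.1 hmem
    refine ⟨lt_of_le_of_ne hx.1 ?_, lt_of_le_of_ne hx.2 ?_⟩
    · rintro rfl
      exact absurd (hzm.trans_le (min_le_left _ _)) (not_lt.2 (h0 y))
    · rintro rfl
      exact absurd (hzm.trans_le (min_le_left _ _)) (not_lt.2 (h1 y))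
  have hxI := Ioo_subset_Icc_self hx
  have hq : δ < speedSq n φ (x, y) := by
    have h2 := hzm.trans_le (min_le_right _ _)
    rw [hz, soundSq_eq] at h2
    rw [hδ, div_lt_iff₀ (by linarith)]
    linarith
  have hEx := ((hasDerivAt_slice_fst F.diff hx y).const_mul Λ).exp
  have hEy := ((hasDerivAt_slice_snd F.diff hxI y).const_mul Λ).exp
  have hzx : HasDerivAt (fun t => z (t, y)) _ x :=
    ((F.hasDerivAt_speedSq_fst hx y).const_mul ((γ - 1) / 2)).const_sub c₀
  have hzy : HasDerivAt (fun t => z (x, t)) _ y :=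
    ((F.hasDerivAt_speedSq_snd hxI y).const_mul ((γ - 1) / 2)).const_sub c₀
  have hΨx := hEx.mul (hzx.sub (hEx.const_mul ε))
  have hΨy := hEy.mul (hzy.sub (hEy.const_mul ε))
  have hcx := IsLocalMin.hasDerivAt_eq_zero (f := fun t => Ψ (t, y)) (a := x) (by
    filter_upwards [Icc_mem_nhds hx.1 hx.2] with t ht
    exact hmin (t, y) (mem_nozzle.2 ht)) hΨx
  have hcy := IsLocalMin.hasDerivAt_eq_zero (f := fun t => Ψ (x, t)) (a := y)
    (Eventually.of_forall fun t => hmin (x, t) (mem_nozzle.2 hxI)) hΨy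
  have hpde := F.eqn (x, y) ⟨hx, mem_univ _⟩
  have hAxy := hAb _ hmem
  have hnx := F.n_pos x hxI
  have hExy := hE (x, y)
  simp only [PotentialFlowEq, ← hz] at hpde
  have hkey : z (x, y) * (a (x, y) + Λ * speedSq n φ (x, y))
      = 2 * ε * Real.exp (Λ * φ (x, y)) * Λ * speedSq n φ (x, y) := by
    have hne := hExy.ne'
    clear_value Λ
    simp only [Pi.sub_apply] at hcx hcy
    generalize Real.exp (Λ * φ (x, y)) = E at hcx hcy hne ⊢
    have hcx' := (mul_eq_zero.1 (show E * (Λ * pd1 φ (x, y) * z (x, y)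
      - 2 * ε * E * Λ * pd1 φ (x, y) - (γ - 1) * (pd1 φ (x, y) * pd11 φ (x, y)
      + pd2 φ (x, y) * pd12 φ (x, y) / n x ^ 2 - pd2 φ (x, y) ^ 2 * deriv n x / n x ^ 3)) = 0 by
        linear_combination hcx)).resolve_left hne
    have hcy' := (mul_eq_zero.1 (show E * (Λ * pd2 φ (x, y) * z (x, y)
      - 2 * ε * E * Λ * pd2 φ (x, y) - (γ - 1) * (pd1 φ (x, y) * pd12 φ (x, y)
      + pd2 φ (x, y) * pd22 φ (x, y) / n x ^ 2)) = 0 by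
        linear_combination hcy)).resolve_left hne
    simp only [ha, speedSq]
    have hnx' := hnx.ne'
    have e : (γ - 1) / n x ^ 2 * (n x ^ 2 * (z (x, y) - pd1 φ (x, y) ^ 2) * pd11 φ (x, y)
      - 2 * pd1 φ (x, y) * pd2 φ (x, y) * pd12 φ (x, y)
      + (z (x, y) - pd2 φ (x, y) ^ 2 / n x ^ 2) * pd22 φ (x, y)
      + n x * deriv n x * (z (x, y) + pd2 φ (x, y) ^ 2 / n x ^ 2) * pd1 φ (x, y)) = 0 := by
      rw [hpde, mul_zero]
    linear_combination (norm := skip) pd1 φ (x, y) * hcx' + pd2 φ (x, y) / n x ^ 2 * hcy' - e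
    field_simp
    ring
  have hAa := abs_le.1 hAxy
  have hΛq : A + 1 < Λ * speedSq n φ (x, y) := by
    rw [← hΛδ]
    exact mul_lt_mul_of_pos_left hq hΛpos
  have hRHS : 0 < ε * Real.exp (Λ * φ (x, y)) := by positivity
  have hpos : 0 < a (x, y) + Λ * speedSq n φ (x, y) := by linarith
  have hle : z (x, y) * (a (x, y) + Λ * speedSq n φ (x, y))
      < ε * Real.exp (Λ * φ (x, y)) * (a (x, y) + Λ * speedSq n φ (x, y)) :=
    mul_lt_mul_of_pos_right hzlt hpos
  have hle' : ε * Real.exp (Λ * φ (x, y)) * (a (x, y) + Λ * speedSq n φ (x, y))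
      ≤ ε * Real.exp (Λ * φ (x, y)) * (2 * (Λ * speedSq n φ (x, y))) :=
    mul_le_mul_of_nonneg_left (by linarith) hRHS.le
  linarith

end PeriodicFlow

/-- The density of the gas as a function of the squared speed. -/
noncomputable def density (γ c₀ t : ℝ) : ℝ := ((c₀ - (γ - 1) / 2 * t) / γ) ^ (1 / (γ - 1))

theorem density_pos {γ c₀ t : ℝ} (hγ : 1 < γ) (ht : 0 < c₀ - (γ - 1) / 2 * t) :
    0 < density γ c₀ t :=
  Real.rpow_pos_of_pos (div_pos ht (by linarith)) _

theorem hasStrictDerivAt_density {γ c₀ t : ℝ} (hγ : 1 < γ) (ht : 0 < c₀ - (γ - 1) / 2 * t) :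
    HasStrictDerivAt (density γ c₀)
      (-(density γ c₀ t / (2 * (c₀ - (γ - 1) / 2 * t)))) t := by
  have hw : 0 < (c₀ - (γ - 1) / 2 * t) / γ := div_pos ht (by linarith)
  have h1 : HasStrictDerivAt (fun s => (c₀ - (γ - 1) / 2 * s) / γ) (-((γ - 1) / 2) / γ) t := by
    simpa using (((hasStrictDerivAt_id t).const_mul ((γ - 1) / 2)).const_sub c₀).div_const γ
  refine ((Real.hasStrictDerivAt_rpow_const_of_ne hw.ne' (1 / (γ - 1))).comp t h1).congr_deriv ?_
  rw [Real.rpow_sub_one hw.ne', density]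
  have : γ - 1 ≠ 0 := by linarith
  have hγ0 : γ ≠ 0 := by linarith
  field_simp

/-- A nonnegative continuous function with vanishing integral over a period is zero. -/
theorem eq_zero_of_integral_period_eq_zero {f : ℝ → ℝ} (hf : Continuous f)
    (hper : Function.Periodic f (2 * Real.pi)) (h0 : ∀ y, 0 ≤ f y)
    (h_int : ∫ y in (0:ℝ)..(2 * Real.pi), f y = 0) (y : ℝ) : f y = 0 := by
  obtain ⟨z, hz, hyz⟩ := hper.exists_mem_Ico₀ Real.two_pi_pos y
  rw [hyz]
  by_contra hne
  exact (intervalIntegral.integral_pos Real.two_pi_pos hf.continuousOn (fun x _ => h0 x)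
    ⟨z, Ico_subset_Icc_self hz, lt_of_le_of_ne (h0 z) (Ne.symm hne)⟩).ne' h_int

/-- The axial mass flux. -/
noncomputable def axialFlux (γ c₀ : ℝ) (n : ℝ → ℝ) (φ : ℝ × ℝ → ℝ) (p : ℝ × ℝ) : ℝ :=
  n p.1 * density γ c₀ (speedSq n φ p) * pd1 φ p

/-- The transversal mass flux. -/
noncomputable def crossFlux (γ c₀ : ℝ) (n : ℝ → ℝ) (φ : ℝ × ℝ → ℝ) (p : ℝ × ℝ) : ℝ :=
  density γ c₀ (speedSq n φ p) * pd2 φ p / n p.1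

/-- A periodic subsonic-sonic flow in the convergent nozzle. -/
structure SubsonicSonicFlow (γ c₀ : ℝ) (n : ℝ → ℝ) (b₀ b₁ : ℝ) (φ : ℝ × ℝ → ℝ) : Prop
    extends PeriodicFlow γ c₀ n φ where
  n_one : n 1 = 1
  one_lt_n : ∀ t ∈ Ico (0:ℝ) 1, 1 < n t
  b₀_pos : 0 < b₀
  b₀_lt : b₀ < b₁
  sonic : c₀ - (γ - 1) / 2 * b₁ ^ 2 = b₁ ^ 2
  exit : ∀ y, pd2 φ (1, y) = 0 ∧ pd1 φ (1, y) = b₁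
  entry : ∀ y, speedSq n φ (0, y) = b₀ ^ 2
  flux_entry : n 0 * density γ c₀ (b₀ ^ 2) * b₀ = density γ c₀ (b₁ ^ 2) * b₁
  soundSq_pos : ∀ p ∈ nozzle, 0 < c₀ - (γ - 1) / 2 * speedSq n φ p

namespace SubsonicSonicFlow

variable {γ c₀ b₀ b₁ : ℝ} {n : ℝ → ℝ} {φ : ℝ × ℝ → ℝ}

theorem contDiffOn_density (F : SubsonicSonicFlow γ c₀ n b₀ b₁ φ) :
    ContDiffOn ℝ 1 (fun p => density γ c₀ (speedSq n φ p)) nozzle := by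
  have hγ := F.one_lt
  refine ContDiffOn.rpow_const_of_ne ((contDiffOn_const.sub
    (contDiffOn_const.mul F.contDiffOn_speedSq)).div_const γ) (fun p hp => ?_)
  exact (div_pos (F.soundSq_pos p hp) (by linarith)).ne'

theorem contDiffOn_axialFlux (F : SubsonicSonicFlow γ c₀ n b₀ b₁ φ) :
    ContDiffOn ℝ 1 (axialFlux γ c₀ n φ) nozzle :=
  (F.contDiff_n.contDiffOn.mul F.contDiffOn_density).mul F.contDiffOn_fst

theorem contDiffOn_crossFlux (F : SubsonicSonicFlow γ c₀ n b₀ b₁ φ) :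
    ContDiffOn ℝ 1 (crossFlux γ c₀ n φ) nozzle :=
  (F.contDiffOn_density.mul F.contDiffOn_snd).div F.contDiff_n.contDiffOn
    (fun _ hp => F.n_ne hp)

theorem periodic_crossFlux (F : SubsonicSonicFlow γ c₀ n b₀ b₁ φ) :
    YPeriodic (crossFlux γ c₀ n φ) := fun x y => by
  simp only [crossFlux, F.periodic_speedSq x y, F.periodic.snd_deriv x y]

theorem pd2_axialFlux (F : SubsonicSonicFlow γ c₀ n b₀ b₁ φ) {x : ℝ} (hx : x ∈ Icc (0:ℝ) 1)
    (y : ℝ) : pd2 (axialFlux γ c₀ n φ) (x, y) =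
      n x * density γ c₀ (speedSq n φ (x, y)) * (pd12 φ (x, y)
        - (pd1 φ (x, y) * pd12 φ (x, y) + pd2 φ (x, y) * pd22 φ (x, y) / n x ^ 2)
          / (c₀ - (γ - 1) / 2 * speedSq n φ (x, y)) * pd1 φ (x, y)) := by
  have hz := F.soundSq_pos _ (mem_nozzle.2 hx : (x, y) ∈ nozzle)
  have h1 := hasDerivAt_slice_snd F.diff_fst hx y
  rw [pd2_pd1_eq_pd12 F.contDiffOn (mem_nozzle.2 hx)] at h1
  have h2 := (hasStrictDerivAt_density F.one_lt hz).hasDerivAt.comp y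
    (F.hasDerivAt_speedSq_snd hx y)
  rw [pd2_eq_of_hasDerivAt (F.contDiffOn_axialFlux.differentiableOn (by norm_num)) hx
    ((h2.const_mul (n x)).mul h1)]
  simp only [Function.comp_apply]
  field_simp
  ring

theorem pd2_crossFlux (F : SubsonicSonicFlow γ c₀ n b₀ b₁ φ) {x : ℝ} (hx : x ∈ Icc (0:ℝ) 1)
    (y : ℝ) : pd2 (crossFlux γ c₀ n φ) (x, y) =
      density γ c₀ (speedSq n φ (x, y)) / n x * (pd22 φ (x, y)
        - (pd1 φ (x, y) * pd12 φ (x, y) + pd2 φ (x, y) * pd22 φ (x, y) / n x ^ 2)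
          / (c₀ - (γ - 1) / 2 * speedSq n φ (x, y)) * pd2 φ (x, y)) := by
  have hz := F.soundSq_pos _ (mem_nozzle.2 hx : (x, y) ∈ nozzle)
  have hn := (F.n_pos x hx).ne'
  have h1 : HasDerivAt (fun t => pd2 φ (x, t)) (pd22 φ (x, y)) y :=
    hasDerivAt_slice_snd F.diff_snd hx y
  have h2 := (hasStrictDerivAt_density F.one_lt hz).hasDerivAt.comp y
    (F.hasDerivAt_speedSq_snd hx y)
  rw [pd2_eq_of_hasDerivAt (F.contDiffOn_crossFlux.differentiableOn (by norm_num)) hx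
    ((h2.mul h1).div_const (n x))]
  simp only [Function.comp_apply]
  field_simp
  ring

theorem pd1_axialFlux (F : SubsonicSonicFlow γ c₀ n b₀ b₁ φ) {x : ℝ} (hx : x ∈ Ioo (0:ℝ) 1)
    (y : ℝ) : pd1 (axialFlux γ c₀ n φ) (x, y) =
      density γ c₀ (speedSq n φ (x, y)) * (deriv n x * pd1 φ (x, y) + n x * pd11 φ (x, y)
        - n x * pd1 φ (x, y) * (pd1 φ (x, y) * pd11 φ (x, y)
          + pd2 φ (x, y) * pd12 φ (x, y) / n x ^ 2 - pd2 φ (x, y) ^ 2 * deriv n x / n x ^ 3)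
          / (c₀ - (γ - 1) / 2 * speedSq n φ (x, y))) := by
  have hxI := Ioo_subset_Icc_self hx
  have hz := F.soundSq_pos _ (mem_nozzle.2 hxI : (x, y) ∈ nozzle)
  have hn := (F.n_pos x hxI).ne'
  have h1 : HasDerivAt (fun t => pd1 φ (t, y)) (pd11 φ (x, y)) x :=
    hasDerivAt_slice_fst F.diff_fst hx y
  have h2 := (hasStrictDerivAt_density F.one_lt hz).hasDerivAt.comp x
    (F.hasDerivAt_speedSq_fst hx y)
  rw [pd1_eq_of_hasDerivAt (F.contDiffOn_axialFlux.differentiableOn (by norm_num)) hx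
    (((F.hasDerivAt_n x).mul h2).mul h1)]
  simp only [Function.comp_apply, Pi.mul_apply]
  field_simp
  ring

/-- Conservation of mass. -/
theorem mass_conservation (F : SubsonicSonicFlow γ c₀ n b₀ b₁ φ) {p : ℝ × ℝ} (hp : p ∈ nozzle) :
    pd1 (axialFlux γ c₀ n φ) p + pd2 (crossFlux γ c₀ n φ) p = 0 := by
  refine Set.EqOn.of_subset_closure (t := nozzle) (g := fun _ => 0) ?_
    ((continuousOn_pd1 F.contDiffOn_axialFlux).add (continuousOn_pd2 F.contDiffOn_crossFlux))
    continuousOn_const (fun _ => mem_nozzle_of_mem_interior) nozzle_eq_closure.le hp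
  rintro ⟨x, y⟩ ⟨hx : x ∈ Ioo (0:ℝ) 1, -⟩
  have hxI := Ioo_subset_Icc_self hx
  have heq := F.eqn (x, y) ⟨hx, mem_univ _⟩
  have hz := F.soundSq_pos _ (mem_nozzle.2 hxI : (x, y) ∈ nozzle)
  have hn := (F.n_pos x hxI).ne'
  simp only [PotentialFlowEq, soundSq_eq] at heq
  simp only [Pi.add_apply, F.pd1_axialFlux hx, F.pd2_crossFlux hxI]
  set z := c₀ - (γ - 1) / 2 * speedSq n φ (x, y)
  clear_value z
  have hz' := hz.ne'
  linear_combination (norm := skip) density γ c₀ (speedSq n φ (x, y)) / (n x * z) * heq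
  field_simp
  ring

theorem b₁_pos (F : SubsonicSonicFlow γ c₀ n b₀ b₁ φ) : 0 < b₁ := F.b₀_pos.trans F.b₀_lt

theorem density_sonic_pos (F : SubsonicSonicFlow γ c₀ n b₀ b₁ φ) : 0 < density γ c₀ (b₁ ^ 2) :=
  density_pos F.one_lt (by rw [F.sonic]; exact pow_pos F.b₁_pos 2)

theorem speedSq_exit (F : SubsonicSonicFlow γ c₀ n b₀ b₁ φ) (y : ℝ) :
    speedSq n φ (1, y) = b₁ ^ 2 := by
  simp [speedSq, F.exit y]

/-- The total mass flux through every cross section is the sonic one. -/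
theorem integral_axialFlux (F : SubsonicSonicFlow γ c₀ n b₀ b₁ φ) {x : ℝ}
    (hx : x ∈ Icc (0:ℝ) 1) :
    ∫ y in (0:ℝ)..(2 * Real.pi), axialFlux γ c₀ n φ (x, y)
      = ∫ _ in (0:ℝ)..(2 * Real.pi), density γ c₀ (b₁ ^ 2) * b₁ := by
  have h := integral_divergence_nozzle F.contDiffOn_axialFlux F.contDiffOn_crossFlux
    F.periodic_crossFlux hx.1 hx.2 le_rfl
  have hzero : EqOn (fun p => pd1 (axialFlux γ c₀ n φ) p + pd2 (crossFlux γ c₀ n φ) p)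
      (fun _ => 0) (Icc (x, (0:ℝ)) (1, 2 * Real.pi)) := fun p hp =>
    F.mass_conservation (mem_nozzle.2 ⟨hx.1.trans hp.1.1, hp.2.1⟩)
  rw [setIntegral_congr_fun measurableSet_Icc hzero] at h
  have he : ∀ y, axialFlux γ c₀ n φ (1, y) = density γ c₀ (b₁ ^ 2) * b₁ := fun y => by
    simp [axialFlux, F.speedSq_exit, F.n_one, F.exit y]
  simp only [integral_zero, he] at h
  linarith

theorem fst_entry_le (F : SubsonicSonicFlow γ c₀ n b₀ b₁ φ) (y : ℝ) : pd1 φ (0, y) ≤ b₀ := by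
  have h := F.entry y
  simp only [speedSq] at h
  have : 0 ≤ pd2 φ (0, y) ^ 2 / n 0 ^ 2 := by positivity
  exact abs_le_of_sq_le_sq' (by linarith) F.b₀_pos.le |>.2

/-- The velocity at the entry is normal to the entry. -/
theorem entry_normal (F : SubsonicSonicFlow γ c₀ n b₀ b₁ φ) (y : ℝ) :
    pd2 φ (0, y) = 0 ∧ pd1 φ (0, y) = b₀ := by
  have h0 : (0:ℝ) ∈ Icc (0:ℝ) 1 := by simp
  have hn := F.n_pos 0 h0
  have hcont := continuous_slice_snd F.contDiffOn_fst.continuousOn h0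
  have hD : 0 < density γ c₀ (b₀ ^ 2) := by
    have := density_pos F.one_lt (F.soundSq_pos (0, y) (mem_nozzle.2 h0))
    rwa [F.entry] at this
  have hfl := F.integral_axialFlux h0
  rw [← F.flux_entry] at hfl
  simp only [axialFlux, F.entry] at hfl
  rw [intervalIntegral.integral_const_mul, intervalIntegral.integral_const] at hfl
  have hα : b₀ - pd1 φ (0, y) = 0 := by
    refine eq_zero_of_integral_period_eq_zero (f := fun y => b₀ - pd1 φ (0, y))
      (continuous_const.sub hcont) (fun t => by simp only [F.periodic.fst_deriv 0 t])
      (fun t => sub_nonneg.2 (F.fst_entry_le t)) ?_ y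
    rw [intervalIntegral.integral_sub (by simp) (hcont.intervalIntegrable _ _),
      intervalIntegral.integral_const, sub_eq_zero]
    refine mul_left_cancel₀ (mul_pos hn hD).ne' ?_
    rw [hfl]
    simp only [smul_eq_mul]
    ring
  have hα' : pd1 φ (0, y) = b₀ := by linarith
  refine ⟨?_, hα'⟩
  have h := F.entry y
  simp only [speedSq, hα'] at h
  have h2 : pd2 φ (0, y) ^ 2 / n 0 ^ 2 = 0 := by linarith
  simpa [hn.ne'] using h2

end SubsonicSonicFlow

section Stokes

variable {f g : ℝ × ℝ → ℝ}

theorem rect_subset_nozzle : Icc ((0:ℝ), (0:ℝ)) (1, 2 * Real.pi) ⊆ nozzle := fun _ hp =>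
  mem_nozzle.2 ⟨hp.1.1, hp.2.1⟩

theorem measurableSet_rect : MeasurableSet (Icc ((0:ℝ), (0:ℝ)) (1, 2 * Real.pi)) :=
  measurableSet_Icc

theorem integrableOn_rect (hf : ContinuousOn f nozzle) :
    IntegrableOn f (Icc ((0:ℝ), (0:ℝ)) (1, 2 * Real.pi)) :=
  (hf.mono rect_subset_nozzle).integrableOn_compact isCompact_Icc

/-- A Jacobian integrates to zero when one factor is constant on each boundary circle. -/
theorem integral_jacobian_eq_zero (hf : ContDiffOn ℝ 1 f nozzle) (hfp : YPeriodic f)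
    (hg : ContDiffOn ℝ 2 g nozzle) (hgp : YPeriodic g) (h0 : ∀ y, pd2 g (0, y) = 0)
    (h1 : ∀ y, pd2 g (1, y) = 0) :
    ∫ p in Icc ((0:ℝ), (0:ℝ)) (1, 2 * Real.pi), (pd1 f p * pd2 g p - pd2 f p * pd1 g p) = 0 := by
  have hg1 := contDiffOn_one_pd1 hg
  have hg2 := contDiffOn_one_pd2 hg
  have hQp : YPeriodic (-(f * pd1 g)) := fun x y => by
    simp only [Pi.neg_apply, Pi.mul_apply, hfp x y, hgp.fst_deriv x y]
  have h := integral_divergence_nozzle (P := f * pd2 g) (Q := -(f * pd1 g)) (hf.mul hg2)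
    (hf.mul hg1).neg hQp le_rfl zero_le_one le_rfl
  have hz : ∀ y, (f * pd2 g) (1, y) = 0 ∧ (f * pd2 g) (0, y) = 0 := fun y => by
    simp [h0, h1]
  simp only [hz, intervalIntegral.integral_zero, sub_zero] at h
  refine Eq.trans ?_ h
  refine setIntegral_congr_fun measurableSet_rect fun p hp => ?_
  have hpn := rect_subset_nozzle hp
  have hu := uniqueDiffOn_nozzle p hpn
  have hfd := hf.differentiableOn (by norm_num) p hpn
  have hd1 := hg1.differentiableOn (by norm_num) p hpn
  have hd2 := hg2.differentiableOn (by norm_num) p hpn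
  have e := pd2_pd1_eq_pd12 hg hpn
  have e1 : pd1 (f * pd2 g) p = f p * pd12 g p + pd2 g p * pd1 f p := by
    simp only [pd1, pd12, fderivWithin_mul hu hfd hd2]
    simp
  have e2 : pd2 (-(f * pd1 g)) p = -(f p * pd2 (pd1 g) p + pd1 g p * pd2 f p) := by
    have : pd2 (-(f * pd1 g)) p = - pd2 (f * pd1 g) p := by
      simp only [pd2, fderivWithin_neg hu]
      simp
    rw [this]
    simp only [pd2, fderivWithin_mul hu hfd hd1]
    simp
  simp only [e1, e2, e]
  ring

theorem pd_translate (hg : ContDiffOn ℝ 2 g nozzle) (hgp : YPeriodic g) (h : ℝ) :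
    ContDiffOn ℝ 2 (fun p => g (p.1, p.2 + h)) nozzle ∧ YPeriodic (fun p => g (p.1, p.2 + h)) ∧
    (∀ p ∈ nozzle, pd1 (fun p => g (p.1, p.2 + h)) p = pd1 g (p.1, p.2 + h)) ∧
    ∀ p ∈ nozzle, pd2 (fun p => g (p.1, p.2 + h)) p = pd2 g (p.1, p.2 + h) := by
  have hmaps : MapsTo (fun p : ℝ × ℝ => (p.1, p.2 + h)) nozzle nozzle := fun p hp =>
    mem_nozzle.2 (mem_nozzle.1 hp)
  have hc : ContDiffOn ℝ 2 (fun p => g (p.1, p.2 + h)) nozzle :=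
    hg.comp (contDiff_fst.prodMk (contDiff_snd.add contDiff_const)).contDiffOn hmaps
  have hd := hc.differentiableOn (by norm_num)
  have hgd := hg.differentiableOn (by norm_num)
  refine ⟨hc, fun x y => ?_, ?_, ?_⟩
  · have := hgp x (y + h)
    rwa [add_right_comm] at this
  · rintro ⟨x, y⟩ hp
    have hx := mem_nozzle.1 hp
    exact pd1_eq_of_hasDerivWithinAt hd hx (hasDerivWithinAt_slice_fst hgd hx (y + h))
  · rintro ⟨x, y⟩ hp
    have hx := mem_nozzle.1 hp
    exact pd2_eq_of_hasDerivAt hd hx ((hasDerivAt_slice_snd hgd hx (y + h)).comp_add_const y h)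

/-- The Jacobian of `f` and `pd2 g` integrates to zero when `g` is constant on each boundary
circle. -/
theorem integral_jacobian_snd_eq_zero (hf : ContDiffOn ℝ 1 f nozzle) (hfp : YPeriodic f)
    (hg : ContDiffOn ℝ 2 g nozzle) (hgp : YPeriodic g) (h0 : ∀ y, pd2 g (0, y) = 0)
    (h1 : ∀ y, pd2 g (1, y) = 0) :
    ∫ p in Icc ((0:ℝ), (0:ℝ)) (1, 2 * Real.pi), (pd1 f p * pd22 g p - pd2 f p * pd12 g p)
      = 0 := by
  have hg1 := contDiffOn_one_pd1 hg
  have hg2 := contDiffOn_one_pd2 hg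
  have hf1 := continuousOn_pd1 hf
  have hf2 := continuousOn_pd2 hf
  obtain ⟨K₁, hK₁, hb₁⟩ := hfp.fst_deriv.exists_bound hf1
  obtain ⟨K₂, hK₂, hb₂⟩ := hfp.snd_deriv.exists_bound hf2
  obtain ⟨L₁, hL₁, hc₁⟩ := hgp.snd_deriv.fst_deriv.exists_bound (continuousOn_pd1 hg2)
  obtain ⟨L₂, hL₂, hc₂⟩ := hgp.snd_deriv.snd_deriv.exists_bound (continuousOn_pd2 hg2)
  set I : ℝ → ℝ × ℝ → ℝ := fun h p =>
    pd1 f p * pd2 g (p.1, p.2 + h) - pd2 f p * pd1 g (p.1, p.2 + h) with hI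
  have hshift : ∀ h, ∀ p ∈ nozzle, (p.1, p.2 + h) ∈ nozzle := fun h p hp =>
    mem_nozzle.2 (mem_nozzle.1 hp)
  have htr : ∀ h, ContinuousOn (fun p : ℝ × ℝ => (p.1, p.2 + h)) nozzle := fun h => by fun_prop
  have hIc : ∀ h, ContinuousOn (I h) nozzle := fun h =>
    (hf1.mul (hg2.continuousOn.comp (htr h) (hshift h))).sub
      (hf2.mul (hg1.continuousOn.comp (htr h) (hshift h)))
  have hI0 : ∀ h, ∫ p in Icc ((0:ℝ), (0:ℝ)) (1, 2 * Real.pi), I h p = 0 := fun h => by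
    obtain ⟨ht, htp, ht1, ht2⟩ := pd_translate hg hgp h
    refine Eq.trans ?_ (integral_jacobian_eq_zero hf hfp ht htp
      (fun y => by rw [ht2 (0, y) (mem_nozzle.2 (by simp))]; exact h0 _)
      (fun y => by rw [ht2 (1, y) (mem_nozzle.2 (by simp))]; exact h1 _))
    refine setIntegral_congr_fun measurableSet_rect fun p hp => ?_
    simp only [hI, ht1 p (rect_subset_nozzle hp), ht2 p (rect_subset_nozzle hp)]
  have hder := hasDerivAt_integral_of_dominated_loc_of_deriv_le
    (μ := volume.restrict (Icc ((0:ℝ), (0:ℝ)) (1, 2 * Real.pi))) (F := I)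
    (F' := fun h p => pd1 f p * pd22 g (p.1, p.2 + h) - pd2 f p * pd12 g (p.1, p.2 + h))
    (x₀ := 0) (s := univ) (bound := fun _ => K₁ * L₂ + K₂ * L₁) univ_mem
    (Eventually.of_forall fun h => (integrableOn_rect (hIc h)).aestronglyMeasurable)
    (integrableOn_rect (hIc 0))
    (integrableOn_rect ((hf1.mul ((continuousOn_pd2 hg2).comp (htr 0) (hshift 0))).sub
      (hf2.mul ((continuousOn_pd1 hg2).comp (htr 0) (hshift 0))))).aestronglyMeasurable
    ?_ (integrableOn_rect continuousOn_const) ?_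
  · have h2 := hder.2
    simp only [hI0, add_zero] at h2
    exact (h2.unique (hasDerivAt_const _ _))
  · filter_upwards [ae_restrict_mem measurableSet_rect] with p hp h _
    have hpn := rect_subset_nozzle hp
    rw [Real.norm_eq_abs]
    refine (abs_sub _ _).trans ?_
    rw [abs_mul, abs_mul]
    exact add_le_add (mul_le_mul (hb₁ p hpn) (hc₂ _ (hshift h p hpn)) (abs_nonneg _) hK₁.le)
      (mul_le_mul (hb₂ p hpn) (hc₁ _ (hshift h p hpn)) (abs_nonneg _) hK₂.le)
  · filter_upwards [ae_restrict_mem measurableSet_rect] with p hp h _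
    have hpn := rect_subset_nozzle hp
    have hx := mem_nozzle.1 hpn
    have e1 := (hasDerivAt_slice_snd (hg1.differentiableOn (by norm_num)) hx
      (p.2 + h)).comp_const_add p.2 h
    rw [pd2_pd1_eq_pd12 hg (hshift h p hpn)] at e1
    have e2 := (hasDerivAt_slice_snd (hg2.differentiableOn (by norm_num)) hx
      (p.2 + h)).comp_const_add p.2 h
    exact (e2.const_mul _).sub (e1.const_mul _)

end Stokes

/-- A smooth function which is positive where `s ^ 2 < a` and vanishes elsewhere. -/
noncomputable def sqBump (a s : ℝ) : ℝ := Real.smoothTransition (a - s ^ 2)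

theorem contDiff_sqBump (a : ℝ) : ContDiff ℝ 1 (sqBump a) :=
  Real.smoothTransition.contDiff.comp (contDiff_const.sub (contDiff_id.pow 2))

theorem sqBump_nonneg (a s : ℝ) : 0 ≤ sqBump a s := Real.smoothTransition.nonneg _

theorem sqBump_pos {a s : ℝ} (h : s ^ 2 < a) : 0 < sqBump a s :=
  Real.smoothTransition.pos_of_pos (by linarith)

theorem sqBump_eq_zero {a s : ℝ} (h : a ≤ s ^ 2) : sqBump a s = 0 :=
  Real.smoothTransition.zero_of_nonpos (by linarith)

/-- The primitive of `sqBump a`. -/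
noncomputable def sqBumpPrim (a s : ℝ) : ℝ := ∫ t in (0:ℝ)..s, sqBump a t

theorem hasDerivAt_sqBumpPrim (a s : ℝ) : HasDerivAt (sqBumpPrim a) (sqBump a s) s :=
  ((contDiff_sqBump a).continuous).integral_hasStrictDerivAt 0 s |>.hasDerivAt

theorem contDiff_sqBumpPrim (a : ℝ) : ContDiff ℝ 1 (sqBumpPrim a) := by
  rw [contDiff_one_iff_deriv]
  refine ⟨fun s => (hasDerivAt_sqBumpPrim a s).differentiableAt, ?_⟩
  rw [funext fun s => (hasDerivAt_sqBumpPrim a s).deriv]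
  exact (contDiff_sqBump a).continuous

theorem sqBumpPrim_eventually_const {a s : ℝ} (h : a < s ^ 2) :
    ∀ᶠ t in 𝓝 s, sqBumpPrim a t = sqBumpPrim a s := by
  have ho : {t : ℝ | a < t ^ 2} ∈ 𝓝 s := (isOpen_lt continuous_const (by fun_prop)).mem_nhds h
  obtain ⟨r, hr, hsub⟩ := Metric.mem_nhds_iff.1 ho
  filter_upwards [Metric.ball_mem_nhds s hr] with t ht
  have hI : ∀ u v, IntervalIntegrable (sqBump a) volume u v :=
    fun u v => (contDiff_sqBump a).continuous.intervalIntegrable u v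
  have hz : ∫ v in s..t, sqBump a v = ∫ _ in s..t, (0:ℝ) := intervalIntegral.integral_congr
    fun v hv => sqBump_eq_zero (hsub ((convex_ball s r).ordConnected.uIcc_subset
      (Metric.mem_ball_self hr) ht hv)).le
  rw [← sub_eq_zero, sqBumpPrim, sqBumpPrim, intervalIntegral.integral_interval_sub_left
    (hI _ _) (hI _ _), hz, intervalIntegral.integral_zero]

namespace SubsonicSonicFlow

variable {γ c₀ b₀ b₁ : ℝ} {n : ℝ → ℝ} {φ : ℝ × ℝ → ℝ}

/-- The axial mass flux with the density frozen at its sonic value in the supersonic region. -/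
noncomputable def cutFlux (γ c₀ b₁ : ℝ) (n : ℝ → ℝ) (φ : ℝ × ℝ → ℝ) (p : ℝ × ℝ) : ℝ :=
  n p.1 * density γ c₀ (min (speedSq n φ p) (b₁ ^ 2)) * pd1 φ p

/-- The weight on the hodograph plane, pulled back to the nozzle. -/
noncomputable def hodographWeight (γ c₀ b₁ a b : ℝ) (n : ℝ → ℝ) (φ : ℝ × ℝ → ℝ)
    (p : ℝ × ℝ) : ℝ :=
  sqBump b (pd2 φ p) * sqBumpPrim a (cutFlux γ c₀ b₁ n φ p)

theorem continuousOn_cutFlux (F : SubsonicSonicFlow γ c₀ n b₀ b₁ φ) :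
    ContinuousOn (cutFlux γ c₀ b₁ n φ) nozzle := by
  have hγ := F.one_lt
  refine (F.contDiff_n.continuous.continuousOn.mul ?_).mul F.contDiffOn_fst.continuousOn
  have hmin : ContinuousOn (fun p => min (speedSq n φ p) (b₁ ^ 2)) nozzle :=
    (continuous_id.min continuous_const).comp_continuousOn F.contDiffOn_speedSq.continuousOn
  refine ((continuousOn_const.sub (continuousOn_const.mul hmin)).div_const γ).rpow_const
    fun p _ => Or.inr (by apply one_div_nonneg.2; linarith)

theorem periodic_hodographWeight (F : SubsonicSonicFlow γ c₀ n b₀ b₁ φ) (a b : ℝ) :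
    YPeriodic (hodographWeight γ c₀ b₁ a b n φ) := fun x y => by
  simp only [hodographWeight, cutFlux, F.periodic_speedSq x y, F.periodic.fst_deriv x y,
    F.periodic.snd_deriv x y]

theorem one_le_n (F : SubsonicSonicFlow γ c₀ n b₀ b₁ φ) {x : ℝ} (hx : x ∈ Icc (0:ℝ) 1) :
    1 ≤ n x := by
  rcases hx.2.lt_or_eq with h | rfl
  · exact (F.one_lt_n x ⟨hx.1, h⟩).le
  · exact F.n_one.ge

theorem sq_lt_cutFlux (F : SubsonicSonicFlow γ c₀ n b₀ b₁ φ) {a b : ℝ} (hb : 0 < b)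
    (hab : a ≤ density γ c₀ (b₁ ^ 2) ^ 2 * (b₁ ^ 2 - b)) {p : ℝ × ℝ} (hp : p ∈ nozzle)
    (hq : b₁ ^ 2 ≤ speedSq n φ p) (hβ : pd2 φ p ^ 2 ≤ b) :
    a < cutFlux γ c₀ b₁ n φ p ^ 2 := by
  obtain ⟨x, y⟩ := p
  have hx := mem_nozzle.1 hp
  have hn := F.n_pos x hx
  have hR := F.density_sonic_pos
  have hb₁ := F.b₁_pos
  have key : b₁ ^ 2 - b < n x ^ 2 * pd1 φ (x, y) ^ 2 := by
    rcases hx.2.lt_or_eq with h | rfl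
    · have h1 := F.one_lt_n x ⟨hx.1, h⟩
      have h2 : n x ^ 2 * speedSq n φ (x, y) = n x ^ 2 * pd1 φ (x, y) ^ 2 + pd2 φ (x, y) ^ 2 := by
        simp only [speedSq]
        field_simp
      have h3 : 1 < n x ^ 2 := by nlinarith
      have h4 : b₁ ^ 2 < n x ^ 2 * speedSq n φ (x, y) := by
        have : 0 < b₁ ^ 2 := by positivity
        nlinarith
      linarith
    · rw [F.n_one, (F.exit y).2]
      linarith
  have e : cutFlux γ c₀ b₁ n φ (x, y) ^ 2
      = density γ c₀ (b₁ ^ 2) ^ 2 * (n x ^ 2 * pd1 φ (x, y) ^ 2) := by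
    simp only [cutFlux, min_eq_right hq]
    ring
  rw [e]
  exact hab.trans_lt (mul_lt_mul_of_pos_left key (by positivity))

theorem hodographWeight_local (F : SubsonicSonicFlow γ c₀ n b₀ b₁ φ) {a b : ℝ} (hb : 0 < b)
    (hab : a ≤ density γ c₀ (b₁ ^ 2) ^ 2 * (b₁ ^ 2 - b)) {p : ℝ × ℝ} (hp : p ∈ nozzle)
    (hq : b₁ ^ 2 ≤ speedSq n φ p) :
    ∃ c, hodographWeight γ c₀ b₁ a b n φ =ᶠ[𝓝[nozzle] p] fun r => sqBump b (pd2 φ r) * c := by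
  rcases le_or_gt (pd2 φ p ^ 2) b with hβ | hβ
  · refine ⟨sqBumpPrim a (cutFlux γ c₀ b₁ n φ p), ?_⟩
    have := (F.continuousOn_cutFlux p hp).eventually
      (sqBumpPrim_eventually_const (F.sq_lt_cutFlux hb hab hp hq hβ))
    filter_upwards [this] with r hr
    rw [hodographWeight, hr]
  · refine ⟨0, ?_⟩
    have := ((F.contDiffOn_snd.continuousOn.pow 2) p hp).eventually (lt_mem_nhds hβ)
    filter_upwards [this] with r hr
    rw [hodographWeight, sqBump_eq_zero (le_of_lt hr), zero_mul, zero_mul]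

theorem hodographWeight_subsonic (F : SubsonicSonicFlow γ c₀ n b₀ b₁ φ) (a b : ℝ) {p : ℝ × ℝ}
    (hp : p ∈ nozzle) (hq : speedSq n φ p < b₁ ^ 2) :
    hodographWeight γ c₀ b₁ a b n φ =ᶠ[𝓝[nozzle] p]
      fun r => sqBump b (pd2 φ r) * sqBumpPrim a (axialFlux γ c₀ n φ r) := by
  filter_upwards [(F.contDiffOn_speedSq.continuousOn p hp).eventually (gt_mem_nhds hq)] with r hr
  rw [hodographWeight, cutFlux, min_eq_left (le_of_lt hr), axialFlux]

theorem contDiffOn_sqBump_snd (F : SubsonicSonicFlow γ c₀ n b₀ b₁ φ) (b : ℝ) :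
    ContDiffOn ℝ 1 (fun r => sqBump b (pd2 φ r)) nozzle :=
  (contDiff_sqBump b).comp_contDiffOn F.contDiffOn_snd

theorem contDiffOn_hodographWeight (F : SubsonicSonicFlow γ c₀ n b₀ b₁ φ) {a b : ℝ} (hb : 0 < b)
    (hab : a ≤ density γ c₀ (b₁ ^ 2) ^ 2 * (b₁ ^ 2 - b)) :
    ContDiffOn ℝ 1 (hodographWeight γ c₀ b₁ a b n φ) nozzle := by
  intro p hp
  rcases lt_or_ge (speedSq n φ p) (b₁ ^ 2) with hq | hq
  · have h := F.hodographWeight_subsonic a b hp hq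
    exact ((F.contDiffOn_sqBump_snd b).mul
      ((contDiff_sqBumpPrim a).comp_contDiffOn F.contDiffOn_axialFlux) p hp).congr_of_eventuallyEq
      h (h.self_of_nhdsWithin hp)
  · obtain ⟨c, h⟩ := F.hodographWeight_local hb hab hp hq
    exact ((F.contDiffOn_sqBump_snd b).mul contDiffOn_const p hp).congr_of_eventuallyEq
      h (h.self_of_nhdsWithin hp)

/-- The Jacobian of the weight and the transversal velocity in the sonic-supersonic region. -/
theorem jacobian_hodographWeight_local (F : SubsonicSonicFlow γ c₀ n b₀ b₁ φ) {a b : ℝ}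
    (hb : 0 < b) (hab : a ≤ density γ c₀ (b₁ ^ 2) ^ 2 * (b₁ ^ 2 - b)) {p : ℝ × ℝ}
    (hp : p ∈ nozzle) (hq : b₁ ^ 2 ≤ speedSq n φ p) :
    pd1 (hodographWeight γ c₀ b₁ a b n φ) p * pd22 φ p
      - pd2 (hodographWeight γ c₀ b₁ a b n φ) p * pd12 φ p = 0 := by
  obtain ⟨c, h⟩ := F.hodographWeight_local hb hab hp hq
  have hβ := (F.diff_snd p hp).hasFDerivWithinAt
  have hk := ((contDiff_sqBump b).differentiable (by norm_num) (pd2 φ p)).hasDerivAt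
  have hd := ((hk.comp_hasFDerivWithinAt p hβ).mul_const c).fderivWithin
    (uniqueDiffOn_nozzle p hp)
  have he := h.fderivWithin_eq (𝕜 := ℝ) (h.self_of_nhdsWithin hp)
  rw [show (fun r => sqBump b (pd2 φ r) * c) = fun r => (sqBump b ∘ pd2 φ) r * c from rfl,
    hd] at he
  simp only [pd1, pd2, pd22, pd12, he]
  simp
  ring

/-- The Jacobian of the weight and the transversal velocity in the subsonic region. -/
theorem jacobian_hodographWeight_subsonic (F : SubsonicSonicFlow γ c₀ n b₀ b₁ φ) (a b : ℝ)
    {p : ℝ × ℝ} (hp : p ∈ nozzle) (hq : speedSq n φ p < b₁ ^ 2) :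
    pd1 (hodographWeight γ c₀ b₁ a b n φ) p * pd22 φ p
      - pd2 (hodographWeight γ c₀ b₁ a b n φ) p * pd12 φ p
      = -(sqBump b (pd2 φ p) * sqBump a (axialFlux γ c₀ n φ p) *
        (pd2 (crossFlux γ c₀ n φ) p * pd22 φ p + pd2 (axialFlux γ c₀ n φ) p * pd12 φ p)) := by
  have h := F.hodographWeight_subsonic a b hp hq
  have hβ := (F.diff_snd p hp).hasFDerivWithinAt
  have hμ := (F.contDiffOn_axialFlux.differentiableOn (by norm_num) p hp).hasFDerivWithinAt
  have hk := ((contDiff_sqBump b).differentiable (by norm_num) (pd2 φ p)).hasDerivAt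
  have hd := ((hk.comp_hasFDerivWithinAt p hβ).mul
    ((hasDerivAt_sqBumpPrim a _).comp_hasFDerivWithinAt p hμ)).fderivWithin
    (uniqueDiffOn_nozzle p hp)
  have he := h.fderivWithin_eq (𝕜 := ℝ) (h.self_of_nhdsWithin hp)
  rw [show (fun r => sqBump b (pd2 φ r) * sqBumpPrim a (axialFlux γ c₀ n φ r)) =
    (sqBump b ∘ pd2 φ) * (sqBumpPrim a ∘ axialFlux γ c₀ n φ) from rfl, hd] at he
  have hm := F.mass_conservation hp
  have hm' : pd2 (crossFlux γ c₀ n φ) p = - pd1 (axialFlux γ c₀ n φ) p := by linarith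
  rw [hm']
  simp only [Function.comp_apply] at he
  generalize sqBump b (pd2 φ p) = k at he ⊢
  simp only [pd1, pd2, pd22, pd12, he]
  simp
  ring

theorem subsonic_ellipticity (F : SubsonicSonicFlow γ c₀ n b₀ b₁ φ)
    {p : ℝ × ℝ} (hp : p ∈ nozzle) (hq : speedSq n φ p < b₁ ^ 2) :
    0 ≤ pd2 (crossFlux γ c₀ n φ) p * pd22 φ p + pd2 (axialFlux γ c₀ n φ) p * pd12 φ p ∧
    (pd2 (crossFlux γ c₀ n φ) p * pd22 φ p + pd2 (axialFlux γ c₀ n φ) p * pd12 φ p = 0 →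
      pd12 φ p = 0 ∧ pd22 φ p = 0) := by
  obtain ⟨x, y⟩ := p
  have hx := mem_nozzle.1 hp
  have hn := F.n_pos x hx
  have hz := F.soundSq_pos _ hp
  have hR := density_pos F.one_lt hz
  have hγ := F.one_lt
  have hzq : speedSq n φ (x, y) < c₀ - (γ - 1) / 2 * speedSq n φ (x, y) := by
    have := F.sonic
    nlinarith
  rw [F.pd2_crossFlux hx, F.pd2_axialFlux hx]
  generalize hQ : density γ c₀ (speedSq n φ (x, y)) = R at hR
  generalize c₀ - (γ - 1) / 2 * speedSq n φ (x, y) = z at hz hzq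
  rw [speedSq] at hzq
  dsimp only at hzq hn ⊢
  generalize pd1 φ (x, y) = α at hzq
  generalize pd2 φ (x, y) = β at hzq
  generalize pd12 φ (x, y) = v
  generalize pd22 φ (x, y) = w
  generalize n x = N at hn hzq
  have hT : R / N * (w - (α * v + β * w / N ^ 2) / z * β) * w
      + N * R * (v - (α * v + β * w / N ^ 2) / z * α) * v
      = N * R / z * ((z - (α ^ 2 + β ^ 2 / N ^ 2)) * (v ^ 2 + (w / N) ^ 2)
        + (α * (w / N) - β / N * v) ^ 2) := by
    field_simp
    ring
  rw [hT]
  have h1 : 0 < N * R / z := by positivity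
  have h2 : 0 ≤ (z - (α ^ 2 + β ^ 2 / N ^ 2)) * (v ^ 2 + (w / N) ^ 2) :=
    mul_nonneg (by linarith) (by positivity)
  refine ⟨mul_nonneg h1.le (by positivity), fun h => ?_⟩
  have h3 := (mul_eq_zero.1 h).resolve_left h1.ne'
  have h4 : (z - (α ^ 2 + β ^ 2 / N ^ 2)) * (v ^ 2 + (w / N) ^ 2) = 0 :=
    le_antisymm (by nlinarith [sq_nonneg (α * (w / N) - β / N * v)]) h2
  have h5 := (mul_eq_zero.1 h4).resolve_left (by linarith)
  have hv : v ^ 2 = 0 := by nlinarith [sq_nonneg v, sq_nonneg (w / N)]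
  have hw : (w / N) ^ 2 = 0 := by nlinarith [sq_nonneg v, sq_nonneg (w / N)]
  exact ⟨by simpa using hv, by simpa [hn.ne'] using hw⟩

theorem rect_subset_closure_interior :
    Icc ((0:ℝ), (0:ℝ)) (1, 2 * Real.pi) ⊆ closure (interior (Icc ((0:ℝ), (0:ℝ)) (1, 2 * Real.pi))) := by
  rw [← Icc_prod_Icc, interior_prod_eq, interior_Icc, interior_Icc, closure_prod_eq,
    closure_Ioo zero_ne_one, closure_Ioo Real.two_pi_pos.ne]

/-- Rigidity of the flow in subsonic regions of the hodograph plane. -/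
theorem snd_derivs_eq_zero (F : SubsonicSonicFlow γ c₀ n b₀ b₁ φ) {a b : ℝ} (hb : 0 < b)
    (hab : a ≤ density γ c₀ (b₁ ^ 2) ^ 2 * (b₁ ^ 2 - b)) {p : ℝ × ℝ} (hp : p ∈ nozzle)
    (hq : speedSq n φ p < b₁ ^ 2) (hμ : axialFlux γ c₀ n φ p ^ 2 < a) (hβ : pd2 φ p ^ 2 < b) :
    pd12 φ p = 0 ∧ pd22 φ p = 0 := by
  set J : ℝ × ℝ → ℝ := fun p => pd1 (hodographWeight γ c₀ b₁ a b n φ) p * pd22 φ p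
      - pd2 (hodographWeight γ c₀ b₁ a b n φ) p * pd12 φ p with hJ
  have hW := F.contDiffOn_hodographWeight hb hab
  have hWp := F.periodic_hodographWeight a b
  have hJc : ContinuousOn J nozzle := ((continuousOn_pd1 hW).mul F.continuousOn_pd22).sub
    ((continuousOn_pd2 hW).mul F.continuousOn_pd12)
  have hJp : YPeriodic J := fun x y => by
    have e1 : pd12 φ (x, y + 2 * Real.pi) = pd12 φ (x, y) := F.periodic.snd_deriv.fst_deriv x y
    have e2 : pd22 φ (x, y + 2 * Real.pi) = pd22 φ (x, y) := F.periodic.snd_deriv.snd_deriv x y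
    simp only [hJ, hWp.fst_deriv x y, hWp.snd_deriv x y, e1, e2]
  have hJle : ∀ r ∈ nozzle, J r ≤ 0 := fun r hr => by
    rcases lt_or_ge (speedSq n φ r) (b₁ ^ 2) with h | h
    · simp only [hJ, F.jacobian_hodographWeight_subsonic a b hr h]
      exact neg_nonpos.2 (mul_nonneg (mul_nonneg (sqBump_nonneg _ _) (sqBump_nonneg _ _))
        (F.subsonic_ellipticity hr h).1)
    · exact (F.jacobian_hodographWeight_local hb hab hr h).le
  have h_int : ∫ r in Icc ((0:ℝ), (0:ℝ)) (1, 2 * Real.pi), -J r = 0 := by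
    rw [integral_neg, neg_eq_zero]
    exact integral_jacobian_snd_eq_zero hW hWp F.contDiffOn F.periodic
      (fun y => (F.entry_normal y).1) (fun y => (F.exit y).1)
  have hae := (setIntegral_eq_zero_iff_of_nonneg_ae (by
    filter_upwards [ae_restrict_mem measurableSet_rect] with r hr
    exact neg_nonneg.2 (hJle r (rect_subset_nozzle hr))) (integrableOn_rect hJc.neg)).1 h_int
  have hzero := Measure.eqOn_of_ae_eq hae (hJc.neg.mono rect_subset_nozzle) continuousOn_const
    rect_subset_closure_interior
  have hJz : J p = 0 := by
    obtain ⟨x, y⟩ := p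
    obtain ⟨t, ht, hte⟩ := hJp.exists_mem_Icc x y
    have hx := mem_nozzle.1 hp
    have := hzero (show (x, t) ∈ _ from ⟨⟨hx.1, ht.1⟩, ⟨hx.2, ht.2⟩⟩)
    rw [← hte]
    simpa using this
  simp only [hJ, F.jacobian_hodographWeight_subsonic a b hp hq] at hJz
  refine (F.subsonic_ellipticity hp hq).2 ?_
  exact (mul_eq_zero.1 (neg_eq_zero.1 hJz)).resolve_left
    (mul_pos (sqBump_pos hβ) (sqBump_pos hμ)).ne'

/-- In the subsonic region the velocity lies outside of an ellipse in the hodograph plane. -/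
theorem le_sq_axialFlux (F : SubsonicSonicFlow γ c₀ n b₀ b₁ φ) {x y : ℝ} (hx : x ∈ Icc (0:ℝ) 1)
    (hq : speedSq n φ (x, y) < b₁ ^ 2) :
    density γ c₀ (b₁ ^ 2) ^ 2 * (b₁ ^ 2 - pd2 φ (x, y) ^ 2) ≤ axialFlux γ c₀ n φ (x, y) ^ 2 := by
  by_contra! hlt
  set D := density γ c₀ (b₁ ^ 2) with hD
  have hDpos : 0 < D := F.density_sonic_pos
  have hb₁ := F.b₁_pos
  set s := b₁ ^ 2 - pd2 φ (x, y) ^ 2 - axialFlux γ c₀ n φ (x, y) ^ 2 / D ^ 2 with hs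
  have hspos : 0 < s := by
    have : axialFlux γ c₀ n φ (x, y) ^ 2 / D ^ 2 < b₁ ^ 2 - pd2 φ (x, y) ^ 2 := by
      rw [div_lt_iff₀ (by positivity)]
      linarith
    linarith
  set b := pd2 φ (x, y) ^ 2 + s / 2 with hb
  have hbpos : 0 < b := by positivity
  set a := axialFlux γ c₀ n φ (x, y) ^ 2 + D ^ 2 * (s / 2) with ha
  have hab : a = D ^ 2 * (b₁ ^ 2 - b) := by
    simp only [ha, hb, hs]
    field_simp
    ring
  have hzero := fun t => F.snd_derivs_eq_zero hbpos hab.le (p := (x, t)) (mem_nozzle.2 hx)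
  set U : Set ℝ := {t | pd1 φ (x, t) = pd1 φ (x, y) ∧ pd2 φ (x, t) = pd2 φ (x, y)} with hU
  have hc1 := continuous_slice_snd F.contDiffOn_fst.continuousOn hx
  have hc2 := continuous_slice_snd F.contDiffOn_snd.continuousOn hx
  have hcq := continuous_slice_snd F.contDiffOn_speedSq.continuousOn hx
  have hcμ := continuous_slice_snd F.contDiffOn_axialFlux.continuousOn hx
  have hUe : ∀ t ∈ U, speedSq n φ (x, t) = speedSq n φ (x, y) ∧
      axialFlux γ c₀ n φ (x, t) = axialFlux γ c₀ n φ (x, y) := fun t ht => by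
    simp only [axialFlux, speedSq, ht.1, ht.2, and_self]
  have hclosed : IsClosed U :=
    (isClosed_eq hc1 continuous_const).inter (isClosed_eq hc2 continuous_const)
  have hopen : IsOpen U := by
    rw [isOpen_iff_mem_nhds]
    intro t ht
    have hev : ∀ᶠ r in 𝓝 t, speedSq n φ (x, r) < b₁ ^ 2 ∧ axialFlux γ c₀ n φ (x, r) ^ 2 < a ∧
        pd2 φ (x, r) ^ 2 < b := by
      refine (hcq.continuousAt.eventually (gt_mem_nhds ?_)).and
        (((hcμ.pow 2).continuousAt.eventually (gt_mem_nhds ?_)).and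
        ((hc2.pow 2).continuousAt.eventually (gt_mem_nhds ?_)))
      · exact (hUe t ht).1.trans_lt hq
      · change axialFlux γ c₀ n φ (x, t) ^ 2 < a
        rw [(hUe t ht).2, ha]
        have : 0 < D ^ 2 * (s / 2) := by positivity
        linarith
      · change pd2 φ (x, t) ^ 2 < b
        rw [ht.2, hb]
        linarith
    obtain ⟨r, hr, hball⟩ := Metric.mem_nhds_iff.1 hev
    filter_upwards [Metric.ball_mem_nhds t hr] with v hv
    have hpre := (convex_ball t r).isPreconnected
    have hd1 : ∀ w ∈ Metric.ball t r, HasDerivAt (fun w => pd1 φ (x, w)) 0 w := fun w hw => by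
      have h := hasDerivAt_slice_snd F.diff_fst hx w
      rw [pd2_pd1_eq_pd12 F.contDiffOn (mem_nozzle.2 hx)] at h
      obtain ⟨e1, e2, e3⟩ := hball hw
      rwa [(hzero w e1 e2 e3).1] at h
    have hd2 : ∀ w ∈ Metric.ball t r, HasDerivAt (fun w => pd2 φ (x, w)) 0 w := fun w hw => by
      have h : HasDerivAt (fun w => pd2 φ (x, w)) (pd22 φ (x, w)) w :=
        hasDerivAt_slice_snd F.diff_snd hx w
      obtain ⟨e1, e2, e3⟩ := hball hw
      rwa [(hzero w e1 e2 e3).2] at h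
    have hconst : ∀ g : ℝ → ℝ, (∀ w ∈ Metric.ball t r, HasDerivAt g 0 w) → g v = g t :=
      fun g hg => Metric.isOpen_ball.is_const_of_deriv_eq_zero hpre
        (fun w hw => (hg w hw).differentiableAt.differentiableWithinAt)
        (fun w hw => (hg w hw).deriv) hv (Metric.mem_ball_self hr)
    exact ⟨(hconst _ hd1).trans ht.1, (hconst _ hd2).trans ht.2⟩
  have huniv : U = univ := IsClopen.eq_univ ⟨hclosed, hopen⟩ ⟨y, rfl, rfl⟩
  have hall : ∀ t, t ∈ U := fun t => huniv ▸ mem_univ t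
  have hβ : pd2 φ (x, y) = 0 :=
    F.periodic.pd2_eq_zero_of_const F.diff hx (fun t => (hall t).2)
  have hfl := F.integral_axialFlux hx
  simp only [fun t => (hUe t (hall t)).2, intervalIntegral.integral_const, smul_eq_mul] at hfl
  have hμ : axialFlux γ c₀ n φ (x, y) = D * b₁ :=
    mul_left_cancel₀ (sub_pos.2 Real.two_pi_pos).ne' hfl
  rw [hβ, hμ] at hlt
  nlinarith

end SubsonicSonicFlow

/-- The velocity is controlled by the mass flux density below the sonic speed. -/
theorem exists_velocity_bound {γ c₀ a₀ : ℝ} (hγ : 1 < γ) (h0 : 0 < a₀)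
    (h1 : a₀ ^ 2 < c₀ - (γ - 1) / 2 * a₀ ^ 2) :
    ∃ L K : ℝ, 0 ≤ L ∧ 0 ≤ K ∧ ∀ᶠ p : (ℝ × ℝ) × (ℝ × ℝ) in 𝓝 ((a₀, 0), (a₀, 0)),
      |p.1.1 - p.2.1| ≤ L * |density γ c₀ (p.1.1 ^ 2 + p.1.2) * p.1.1 -
        density γ c₀ (p.2.1 ^ 2 + p.2.2) * p.2.1| + K * |p.1.2 - p.2.2| := by
  set z := c₀ - (γ - 1) / 2 * a₀ ^ 2 with hz
  have hzpos : 0 < z := (pow_pos h0 2).trans h1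
  set R := density γ c₀ (a₀ ^ 2) with hR
  have hRpos : 0 < R := density_pos hγ hzpos
  have hd : HasStrictDerivAt (density γ c₀) (-(R / (2 * z))) (a₀ ^ 2 + 0) := by
    rw [add_zero]
    exact hasStrictDerivAt_density hγ hzpos
  have hsq : HasStrictFDerivAt (fun q : ℝ × ℝ => q.1 ^ 2 + q.2)
      ((2 * a₀) • ContinuousLinearMap.fst ℝ ℝ ℝ + ContinuousLinearMap.snd ℝ ℝ ℝ) (a₀, 0) := by
    have := ((hasStrictFDerivAt_fst (𝕜 := ℝ) (p := (a₀, (0:ℝ)))).pow 2).add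
      (hasStrictFDerivAt_snd (𝕜 := ℝ) (p := (a₀, (0:ℝ))))
    refine (this.congr_fderiv ?_)
    simp
  have hG := (HasStrictDerivAt.comp_hasStrictFDerivAt (a₀, (0:ℝ)) hd hsq).mul
    (hasStrictFDerivAt_fst (𝕜 := ℝ) (p := (a₀, (0:ℝ))))
  set c := R * (1 - a₀ ^ 2 / z) with hc
  have hcpos : 0 < c := mul_pos hRpos (sub_pos.2 ((div_lt_one hzpos).2 h1))
  have hlo := hG.isLittleO.def (half_pos hcpos)
  refine ⟨2 / c, 2 / c * (|a₀ * (R / (2 * z))| + c / 2), by positivity, by positivity, ?_⟩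
  filter_upwards [hlo] with p hp
  set A := density γ c₀ (p.1.1 ^ 2 + p.1.2) * p.1.1 -
        density γ c₀ (p.2.1 ^ 2 + p.2.2) * p.2.1 with hA
  have hlin : ‖A - (c * (p.1.1 - p.2.1) - a₀ * (R / (2 * z)) * (p.1.2 - p.2.2))‖ ≤
      c / 2 * ‖p.1 - p.2‖ := by
    refine le_of_eq_of_le (congrArg _ ?_) hp
    simp only [hA, hc, Function.comp, Pi.mul_apply, add_apply, smul_apply,
      Prod.fst_sub, Prod.snd_sub, ContinuousLinearMap.coe_fst', ContinuousLinearMap.coe_snd',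
      smul_eq_mul, add_zero, ← hR]
    field_simp
    ring
  have hnorm : ‖p.1 - p.2‖ ≤ |p.1.1 - p.2.1| + |p.1.2 - p.2.2| := by
    rw [Prod.norm_def]
    exact max_le (le_add_of_nonneg_right (abs_nonneg _)) (le_add_of_nonneg_left (abs_nonneg _))
  rw [Real.norm_eq_abs] at hlin
  have h2 : c * |p.1.1 - p.2.1| ≤ |A| + |a₀ * (R / (2 * z))| * |p.1.2 - p.2.2| +
      c / 2 * (|p.1.1 - p.2.1| + |p.1.2 - p.2.2|) := by
    calc c * |p.1.1 - p.2.1| = |c * (p.1.1 - p.2.1)| := by rw [abs_mul, abs_of_pos hcpos]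
      _ = |A + a₀ * (R / (2 * z)) * (p.1.2 - p.2.2) -
          (A - (c * (p.1.1 - p.2.1) - a₀ * (R / (2 * z)) * (p.1.2 - p.2.2)))| := by
        congr 1; ring
      _ ≤ |A + a₀ * (R / (2 * z)) * (p.1.2 - p.2.2)| +
          |A - (c * (p.1.1 - p.2.1) - a₀ * (R / (2 * z)) * (p.1.2 - p.2.2))| := abs_sub _ _
      _ ≤ _ := add_le_add ((abs_add_le _ _).trans_eq (by rw [abs_mul _ (p.1.2 - p.2.2)]))
        (hlin.trans (mul_le_mul_of_nonneg_left hnorm (half_pos hcpos).le))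
  have h3 : c / 2 * |p.1.1 - p.2.1| ≤ |A| + (|a₀ * (R / (2 * z))| + c / 2) * |p.1.2 - p.2.2| := by
    linarith
  calc |p.1.1 - p.2.1| = 2 / c * (c / 2 * |p.1.1 - p.2.1|) := by field_simp
    _ ≤ 2 / c * (|A| + (|a₀ * (R / (2 * z))| + c / 2) * |p.1.2 - p.2.2|) :=
      mul_le_mul_of_nonneg_left h3 (by positivity)
    _ = _ := by ring

/-- A Gronwall-type lemma for the integral of the absolute value over a period. -/
theorem eqOn_zero_of_integral_abs_le {V : ℝ → ℝ → ℝ} (hV : Continuous (Function.uncurry V))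
    {X Z K T : ℝ} (hXZ : X ≤ Z) (hT : 0 ≤ T) (hK : 0 ≤ K) (hKZ : K * (Z - X) ≤ 1 / 2)
    (h : ∀ x ∈ Icc X Z, ∫ y in (0:ℝ)..T, |V x y| ≤ K * ∫ y in (0:ℝ)..T, |∫ t in X..x, V t y|) :
    ∀ x ∈ Icc X Z, ∫ y in (0:ℝ)..T, |V x y| = 0 := by
  set G : ℝ → ℝ := fun x => ∫ y in (0:ℝ)..T, |V x y| with hG
  have hVa : Continuous (Function.uncurry fun x y => |V x y|) := hV.abs
  have hGc : Continuous G :=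
    intervalIntegral.continuous_parametric_intervalIntegral_of_continuous' hVa 0 T
  have hG0 : ∀ x, 0 ≤ G x := fun x => intervalIntegral.integral_nonneg hT fun y _ => abs_nonneg _
  obtain ⟨x₀, hx₀, hmax⟩ := isCompact_Icc.exists_isMaxOn (nonempty_Icc.2 hXZ) hGc.continuousOn
  have hW : Continuous (fun y => |∫ t in X..x₀, V t y|) :=
    (intervalIntegral.continuous_parametric_intervalIntegral_of_continuous'
      (f := fun y t => V t y) (hV.comp continuous_swap) X x₀).abs
  have hWa : Continuous (fun y => ∫ t in X..x₀, |V t y|) :=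
    intervalIntegral.continuous_parametric_intervalIntegral_of_continuous'
      (f := fun y t => |V t y|) (hVa.comp continuous_swap) X x₀
  have h1 : ∫ y in (0:ℝ)..T, |∫ t in X..x₀, V t y| ≤ ∫ t in X..x₀, G t := by
    calc ∫ y in (0:ℝ)..T, |∫ t in X..x₀, V t y|
        ≤ ∫ y in (0:ℝ)..T, ∫ t in X..x₀, |V t y| :=
          intervalIntegral.integral_mono_on hT (hW.intervalIntegrable _ _)
            (hWa.intervalIntegrable _ _) fun y _ =>
            intervalIntegral.abs_integral_le_integral_abs hx₀.1
      _ = ∫ t in X..x₀, G t := by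
        rw [hG]
        refine intervalIntegral_intervalIntegral_swap ?_
        exact ((hVa.comp continuous_swap).continuousOn.integrableOn_compact
          (isCompact_uIcc.prod isCompact_uIcc)).mono_set
            (prod_mono uIoc_subset_uIcc uIoc_subset_uIcc)
  have h2 : ∫ t in X..x₀, G t ≤ (x₀ - X) * G x₀ := by
    calc ∫ t in X..x₀, G t ≤ ∫ _ in X..x₀, G x₀ :=
          intervalIntegral.integral_mono_on hx₀.1 (hGc.intervalIntegrable _ _)
            intervalIntegrable_const fun t ht => hmax ⟨ht.1, ht.2.trans hx₀.2⟩
      _ = (x₀ - X) * G x₀ := by rw [intervalIntegral.integral_const, smul_eq_mul]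
  have h3 : G x₀ ≤ 1 / 2 * G x₀ := by
    calc G x₀ ≤ K * ∫ y in (0:ℝ)..T, |∫ t in X..x₀, V t y| := h x₀ hx₀
      _ ≤ K * ((x₀ - X) * G x₀) := mul_le_mul_of_nonneg_left (h1.trans h2) hK
      _ ≤ K * ((Z - X) * G x₀) := by
        have := hx₀.2
        have := hG0 x₀
        gcongr
      _ = K * (Z - X) * G x₀ := by ring
      _ ≤ 1 / 2 * G x₀ := mul_le_mul_of_nonneg_right hKZ (hG0 _)
  intro x hx
  have h4 : G x ≤ G x₀ := hmax hx
  exact le_antisymm (by linarith [hG0 x₀]) (hG0 x)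

/-- The one-dimensional flow `u` with potential `φb` carrying the sonic mass flux. -/
structure AxialFlow (γ c₀ : ℝ) (n : ℝ → ℝ) (b₁ : ℝ) (u φb : ℝ → ℝ) : Prop where
  continuousOn : ContinuousOn u (Icc 0 1)
  pos : ∀ x ∈ Icc (0:ℝ) 1, 0 < u x
  subsonic : ∀ x ∈ Ico (0:ℝ) 1, u x < b₁
  flux : ∀ x ∈ Icc (0:ℝ) 1, n x * density γ c₀ (u x ^ 2) * u x = density γ c₀ (b₁ ^ 2) * b₁
  potential : ∀ x ∈ Icc (0:ℝ) 1, HasDerivWithinAt φb (u x) (Icc 0 1) x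

namespace SubsonicSonicFlow

variable {γ c₀ b₀ b₁ : ℝ} {n : ℝ → ℝ} {φ : ℝ × ℝ → ℝ} {u φb : ℝ → ℝ}

theorem velocity_le_of_eq (F : SubsonicSonicFlow γ c₀ n b₀ b₁ φ) (B : AxialFlow γ c₀ n b₁ u φb)
    {X : ℝ} (hX : X ∈ Ico (0:ℝ) 1) (h1 : ∀ y, pd1 φ (X, y) = u X) (h2 : ∀ y, pd2 φ (X, y) = 0) :
    ∃ L K : ℝ, 0 ≤ L ∧ 0 ≤ K ∧ ∀ᶠ x in 𝓝 X, x ∈ Icc (0:ℝ) 1 →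
      ∀ y ∈ Icc (0:ℝ) (2 * Real.pi), |pd1 φ (x, y) - u x| ≤
        L * (axialFlux γ c₀ n φ (x, y) - density γ c₀ (b₁ ^ 2) * b₁) + K * pd2 φ (x, y) ^ 2 := by
  have hγ := F.one_lt
  have hb₁ := F.b₁_pos
  have hXI := Ico_subset_Icc_self hX
  have hu0 := B.pos X hXI
  have hu1 := B.subsonic X hX
  have hsub : u X ^ 2 < b₁ ^ 2 := pow_lt_pow_left₀ hu1 hu0.le two_ne_zero
  have hz : u X ^ 2 < c₀ - (γ - 1) / 2 * u X ^ 2 := by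
    have := F.sonic
    nlinarith
  obtain ⟨L, K, hL, hK, hLK⟩ := exists_velocity_bound hγ hu0 hz
  set D := density γ c₀ (b₁ ^ 2) with hD
  have hDpos : 0 < D := F.density_sonic_pos
  refine ⟨L, L * (2 * D / b₁) + K, hL, by positivity, ?_⟩
  have hev : ∀ᶠ x in 𝓝 X, ∀ y ∈ Icc (0:ℝ) (2 * Real.pi), (x, y) ∈ nozzle →
      0 < pd1 φ (x, y) ∧ speedSq n φ (x, y) < b₁ ^ 2 ∧
      |pd1 φ (x, y) - u x| ≤ L * |density γ c₀ (pd1 φ (x, y) ^ 2 + pd2 φ (x, y) ^ 2 / n x ^ 2) *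
        pd1 φ (x, y) - density γ c₀ (u x ^ 2 + 0) * u x| +
        K * |pd2 φ (x, y) ^ 2 / n x ^ 2 - 0| := by
    refine isCompact_Icc.eventually_forall_of_forall_eventually fun y _ => ?_
    have hmem : (X, y) ∈ nozzle := mem_nozzle.2 hXI
    have c1 := F.contDiffOn_fst.continuousOn (X, y) hmem
    have c2 := F.contDiffOn_snd.continuousOn (X, y) hmem
    have cq := F.contDiffOn_speedSq.continuousOn (X, y) hmem
    have cn : ContinuousWithinAt (fun p : ℝ × ℝ => n p.1) nozzle (X, y) :=
      F.contDiff_n.continuous.continuousWithinAt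
    have cu : ContinuousWithinAt (fun p : ℝ × ℝ => u p.1) nozzle (X, y) :=
      (B.continuousOn.comp continuous_fst.continuousOn fun p hp => mem_nozzle.1 hp) (X, y) hmem
    have ct := (c2.pow 2).div (cn.pow 2) (pow_ne_zero 2 (F.n_ne hmem))
    have hmap := (c1.prodMk ct).prodMk (cu.prodMk (continuousWithinAt_const (b := (0:ℝ))))
    have hval : pd2 φ (X, y) ^ 2 / n X ^ 2 = 0 := by rw [h2]; simp
    have hq : speedSq n φ (X, y) < b₁ ^ 2 := by
      change pd1 φ (X, y) ^ 2 + pd2 φ (X, y) ^ 2 / n X ^ 2 < b₁ ^ 2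
      rwa [hval, h1, add_zero]
    have e1 := c1.eventually (lt_mem_nhds (by rw [h1]; exact hu0))
    have e2 := cq.eventually (gt_mem_nhds hq)
    have e3 := hmap.eventually (p := fun p : (ℝ × ℝ) × (ℝ × ℝ) => |p.1.1 - p.2.1| ≤
      L * |density γ c₀ (p.1.1 ^ 2 + p.1.2) * p.1.1 -
        density γ c₀ (p.2.1 ^ 2 + p.2.2) * p.2.1| + K * |p.1.2 - p.2.2|)
        (by simp only [Pi.div_apply, Pi.pow_apply, hval, h1]; exact hLK)
    refine eventually_nhdsWithin_iff.1 ?_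
    filter_upwards [e1, e2, e3] with p a1 a2 a3
    exact ⟨a1, a2, a3⟩
  filter_upwards [hev] with x hx hxI y hy
  obtain ⟨a1, a2, a3⟩ := hx y hy (mem_nozzle.2 hxI)
  refine a3.trans ?_
  have hn1 := F.one_le_n hxI
  have hnpos : 0 < n x := by linarith
  have hμ := F.le_sq_axialFlux hxI a2
  set μ := axialFlux γ c₀ n φ (x, y) with hμd
  have hμpos : 0 < μ := by
    have := density_pos hγ (F.soundSq_pos (x, y) (mem_nozzle.2 hxI))
    rw [hμd, axialFlux]
    positivity
  have hflux : density γ c₀ (pd1 φ (x, y) ^ 2 + pd2 φ (x, y) ^ 2 / n x ^ 2) *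
        pd1 φ (x, y) - density γ c₀ (u x ^ 2 + 0) * u x = (μ - D * b₁) / n x := by
    rw [eq_div_iff hnpos.ne', hμd, ← B.flux x hxI, axialFlux, add_zero]
    simp only [speedSq]
    ring
  have habs : |(μ - D * b₁) / n x| ≤ (μ - D * b₁) + 2 * D / b₁ * pd2 φ (x, y) ^ 2 := by
    rw [abs_div, abs_of_pos hnpos]
    refine (div_le_self (abs_nonneg _) hn1).trans (abs_le'.2 ⟨?_, ?_⟩)
    · have : 0 ≤ 2 * D / b₁ * pd2 φ (x, y) ^ 2 := by positivity
      linarith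
    · have h3 : (D * b₁ - μ) * (D * b₁) ≤ D ^ 2 * pd2 φ (x, y) ^ 2 := by
        rcases le_total (D * b₁) μ with h | h
        · have : 0 ≤ (μ - D * b₁) * (D * b₁) := mul_nonneg (sub_nonneg.2 h) (by positivity)
          have : 0 ≤ D ^ 2 * pd2 φ (x, y) ^ 2 := by positivity
          linarith
        · have : 0 ≤ (D * b₁ - μ) * μ := mul_nonneg (sub_nonneg.2 h) hμpos.le
          nlinarith
      have h4 : D * b₁ - μ ≤ D / b₁ * pd2 φ (x, y) ^ 2 := by
        rw [← mul_le_mul_iff_left₀ (mul_pos hDpos hb₁)]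
        refine h3.trans_eq ?_
        field_simp
      have h5 : 2 * D / b₁ * pd2 φ (x, y) ^ 2 = 2 * (D / b₁ * pd2 φ (x, y) ^ 2) := by ring
      linarith
  have hsnd : |pd2 φ (x, y) ^ 2 / n x ^ 2 - 0| ≤ pd2 φ (x, y) ^ 2 := by
    rw [sub_zero, abs_of_nonneg (by positivity)]
    exact div_le_self (sq_nonneg _) (one_le_pow₀ hn1)
  rw [hflux]
  calc _ ≤ L * ((μ - D * b₁) + 2 * D / b₁ * pd2 φ (x, y) ^ 2) + K * pd2 φ (x, y) ^ 2 :=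
        add_le_add (mul_le_mul_of_nonneg_left habs hL) (mul_le_mul_of_nonneg_left hsnd hK)
    _ = _ := by ring

theorem exists_integral_sq_snd_le (F : SubsonicSonicFlow γ c₀ n b₀ b₁ φ) :
    ∃ K : ℝ, 0 < K ∧ ∀ x ∈ Icc (0:ℝ) 1, ∀ c : ℝ,
      ∫ y in (0:ℝ)..(2 * Real.pi), pd2 φ (x, y) ^ 2 ≤
        K * ∫ y in (0:ℝ)..(2 * Real.pi), |φ (x, y) - c| := by
  obtain ⟨K, hK, hbd⟩ := F.periodic.snd_deriv.snd_deriv.exists_bound F.continuousOn_pd22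
  refine ⟨K, hK, fun x hx c => ?_⟩
  have cφ := continuous_slice_snd F.contDiffOn.continuousOn hx
  have c2 := continuous_slice_snd F.contDiffOn_snd.continuousOn hx
  have c22 := continuous_slice_snd F.continuousOn_pd22 hx
  have hpar := intervalIntegral.integral_mul_deriv_eq_deriv_mul (a := 0) (b := 2 * Real.pi)
    (fun y _ => (hasDerivAt_slice_snd F.diff hx y).sub_const c)
    (fun y _ => hasDerivAt_slice_snd F.diff_snd hx y)
    (c2.intervalIntegrable _ _) (c22.intervalIntegrable _ _)
  have e1 := F.periodic x 0
  have e2 := F.periodic.snd_deriv x 0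
  rw [zero_add] at e1 e2
  rw [e1, e2, sub_self, zero_sub] at hpar
  have hsq : ∫ y in (0:ℝ)..(2 * Real.pi), pd2 φ (x, y) ^ 2 =
      ∫ y in (0:ℝ)..(2 * Real.pi), -((φ (x, y) - c) * pd2 (pd2 φ) (x, y)) := by
    rw [intervalIntegral.integral_neg, hpar, neg_neg]
    simp only [sq]
  rw [hsq, ← intervalIntegral.integral_const_mul]
  refine intervalIntegral.integral_mono_on Real.two_pi_pos.le
    (((cφ.sub continuous_const).mul c22).neg.intervalIntegrable _ _)
    ((continuous_const.mul (cφ.sub continuous_const).abs).intervalIntegrable _ _) fun y _ => ?_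
  refine (neg_le_abs _).trans ?_
  rw [abs_mul, mul_comm]
  exact mul_le_mul_of_nonneg_right (hbd _ (mem_nozzle.2 hx)) (abs_nonneg _)

theorem integral_velocity_le_of_eq (F : SubsonicSonicFlow γ c₀ n b₀ b₁ φ)
    (B : AxialFlow γ c₀ n b₁ u φb)
    {X : ℝ} (hX : X ∈ Ico (0:ℝ) 1) (h1 : ∀ y, pd1 φ (X, y) = u X) (h2 : ∀ y, pd2 φ (X, y) = 0) :
    ∃ K : ℝ, 0 ≤ K ∧ ∀ᶠ x in 𝓝 X, x ∈ Icc (0:ℝ) 1 → ∀ c : ℝ,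
      ∫ y in (0:ℝ)..(2 * Real.pi), |pd1 φ (x, y) - u x| ≤
        K * ∫ y in (0:ℝ)..(2 * Real.pi), |φ (x, y) - c| := by
  obtain ⟨L, K, hL, hK, hev⟩ := F.velocity_le_of_eq B hX h1 h2
  obtain ⟨M, hM, hle⟩ := F.exists_integral_sq_snd_le
  refine ⟨K * M, by positivity, ?_⟩
  filter_upwards [hev] with x hx hxI c
  have c1 := continuous_slice_snd F.contDiffOn_fst.continuousOn hxI
  have c2 := continuous_slice_snd F.contDiffOn_snd.continuousOn hxI
  have cμ := continuous_slice_snd F.contDiffOn_axialFlux.continuousOn hxI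
  have i1 : Continuous fun y =>
      L * (axialFlux γ c₀ n φ (x, y) - density γ c₀ (b₁ ^ 2) * b₁) :=
    continuous_const.mul (cμ.sub continuous_const)
  have i2 : Continuous fun y => K * pd2 φ (x, y) ^ 2 := continuous_const.mul (c2.pow 2)
  calc ∫ y in (0:ℝ)..(2 * Real.pi), |pd1 φ (x, y) - u x|
      ≤ ∫ y in (0:ℝ)..(2 * Real.pi),
        (L * (axialFlux γ c₀ n φ (x, y) - density γ c₀ (b₁ ^ 2) * b₁) + K * pd2 φ (x, y) ^ 2) :=
        intervalIntegral.integral_mono_on Real.two_pi_pos.le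
          ((c1.sub continuous_const).abs.intervalIntegrable _ _)
          ((i1.add i2).intervalIntegrable _ _) (hx hxI)
    _ = K * ∫ y in (0:ℝ)..(2 * Real.pi), pd2 φ (x, y) ^ 2 := by
      rw [intervalIntegral.integral_add (i1.intervalIntegrable _ _) (i2.intervalIntegrable _ _),
        intervalIntegral.integral_const_mul, intervalIntegral.integral_const_mul,
        intervalIntegral.integral_sub (cμ.intervalIntegrable _ _) intervalIntegrable_const,
        F.integral_axialFlux hxI, sub_self, mul_zero, zero_add]
    _ ≤ K * (M * ∫ y in (0:ℝ)..(2 * Real.pi), |φ (x, y) - c|) :=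
      mul_le_mul_of_nonneg_left (hle x hxI c) hK
    _ = _ := by ring

/-- Local continuation of the equality with the axial flow. -/
theorem eventually_eq_of_eq (F : SubsonicSonicFlow γ c₀ n b₀ b₁ φ)
    (B : AxialFlow γ c₀ n b₁ u φb) {C : ℝ}
    {X : ℝ} (hX : X ∈ Ico (0:ℝ) 1) (h0 : ∀ y, φ (X, y) = φb X + C)
    (h1 : ∀ y, pd1 φ (X, y) = u X) :
    ∀ᶠ x in 𝓝[>] X, ∀ y, φ (x, y) = φb x + C ∧ pd1 φ (x, y) = u x := by
  have hXI := Ico_subset_Icc_self hX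
  have h2 : ∀ y, pd2 φ (X, y) = 0 := fun y =>
    pd2_eq_of_hasDerivAt F.diff hXI (by simpa only [h0] using hasDerivAt_const y _)
  obtain ⟨K, hK, hev⟩ := F.integral_velocity_le_of_eq B hX h1 h2
  have hKc : ∀ᶠ x in 𝓝 X, K * (x - X) < 1 / 2 ∧ x < 1 := by
    refine Filter.Eventually.and ?_ (gt_mem_nhds hX.2)
    have : ContinuousAt (fun x => K * (x - X)) X := by fun_prop
    exact this.eventually (gt_mem_nhds (by simp))
  obtain ⟨r, hr, hball⟩ := Metric.eventually_nhds_iff_ball.1 (hev.and hKc)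
  set Z := X + r / 2 with hZ
  have hXZ : X < Z := by linarith
  have hmem : ∀ x ∈ Icc X Z, x ∈ Metric.ball X r := fun x hx => by
    rw [Metric.mem_ball, Real.dist_eq, abs_of_nonneg (sub_nonneg.2 hx.1)]
    linarith [hx.2]
  have hI : ∀ x ∈ Icc X Z, x ∈ Icc (0:ℝ) 1 := fun x hx =>
    ⟨hX.1.trans hx.1, (hball x (hmem x hx)).2.2.le⟩
  set k : ℝ → ℝ := fun x => max 0 (min 1 x) with hk
  have hkI : ∀ x, k x ∈ Icc (0:ℝ) 1 := fun x =>
    ⟨le_max_left _ _, max_le zero_le_one (min_le_left _ _)⟩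
  have hkc : Continuous k := by fun_prop
  have hkx : ∀ x ∈ Icc (0:ℝ) 1, k x = x := fun x hx => by
    simp only [hk, min_eq_right hx.2, max_eq_right hx.1]
  set V : ℝ → ℝ → ℝ := fun x y => pd1 φ (k x, y) - u (k x) with hV
  have hVc : Continuous (Function.uncurry V) := by
    refine Continuous.sub ?_ ?_
    · exact F.contDiffOn_fst.continuousOn.comp_continuous
        ((hkc.comp continuous_fst).prodMk continuous_snd) fun p => mem_nozzle.2 (hkI p.1)
    · exact B.continuousOn.comp_continuous (hkc.comp continuous_fst) fun p => hkI p.1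
  have hW : ∀ x ∈ Icc X Z, ∀ y, ∫ t in X..x, V t y = φ (x, y) - (φb x + C) := by
    intro x hx y
    have hcφ : ContinuousOn (fun t => φ (t, y) - (φb t + C)) (Icc X x) := by
      refine ContinuousOn.mono (s := Icc 0 1) ?_ fun t ht => hI t ⟨ht.1, ht.2.trans hx.2⟩
      refine ContinuousOn.sub (fun t ht => ?_) (ContinuousOn.add (fun t ht => ?_)
        continuousOn_const)
      · exact (hasDerivWithinAt_slice_fst F.diff ht y).continuousWithinAt
      · exact (B.potential t ht).continuousWithinAt
    have := intervalIntegral.integral_eq_sub_of_hasDerivAt_of_le hx.1 hcφ (f' := fun t => V t y)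
      (fun t ht => ?_) ((hVc.comp (by fun_prop : Continuous fun t => (t, y))).intervalIntegrable _ _)
    · rw [this, h0, sub_self, sub_zero]
    · have htI : t ∈ Icc (0:ℝ) 1 := hI t ⟨ht.1.le, ht.2.le.trans hx.2⟩
      have htO : t ∈ Ioo (0:ℝ) 1 :=
        ⟨hX.1.trans_lt ht.1, ht.2.trans_le (hI x hx).2⟩
      simp only [hV, hkx t htI]
      exact (hasDerivAt_slice_fst F.diff htO y).sub
        (((B.potential t htI).hasDerivAt (Icc_mem_nhds htO.1 htO.2)).add_const C)
  have hzero := eqOn_zero_of_integral_abs_le hVc hXZ.le Real.two_pi_pos.le hK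
    (hball Z (hmem Z ⟨hXZ.le, le_rfl⟩)).2.1.le (fun x hx => by
      have := (hball x (hmem x hx)).1 (hI x hx) (φb x + C)
      simp only [hW x hx]
      simpa only [hV, hkx x (hI x hx)] using this)
  have hV0 : ∀ x ∈ Icc X Z, ∀ y, V x y = 0 := fun x hx y =>
    abs_eq_zero.1 (eq_zero_of_integral_period_eq_zero
      ((hVc.comp (by fun_prop : Continuous fun t => (x, t))).abs)
      (fun t => by simp only [Function.comp, Function.uncurry, hV, F.periodic.fst_deriv (k x) t])
      (fun t => abs_nonneg _) (hzero x hx) y)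
  filter_upwards [Ioo_mem_nhdsGT hXZ] with x hx y
  have hxI := Ioo_subset_Icc_self hx
  constructor
  · have h3 := hW x hxI y
    rw [intervalIntegral.integral_congr (g := fun _ => (0:ℝ)) fun t ht => by
      rw [uIcc_of_le hxI.1] at ht
      exact hV0 t ⟨ht.1, ht.2.trans hxI.2⟩ y, intervalIntegral.integral_zero] at h3
    linarith
  · have h3 := hV0 x hxI y
    simp only [hV, hkx x (hI x hxI)] at h3
    linarith

/-- A subsonic-sonic flow agrees with the axial flow up to a constant. -/
theorem eq_axialFlow (F : SubsonicSonicFlow γ c₀ n b₀ b₁ φ) (B : AxialFlow γ c₀ n b₁ u φb)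
    (hu0 : u 0 = b₀) :
    ∃ C : ℝ, (∀ p ∈ nozzle, φ p = φb p.1 + C) ∧
      (∀ p ∈ nozzle, pd2 φ p = 0 ∧ pd1 φ p = u p.1) := by
  have h0I : (0:ℝ) ∈ Icc (0:ℝ) 1 := ⟨le_rfl, zero_le_one⟩
  set C := φ (0, 0) - φb 0 with hC
  set S : Set ℝ := {x | ∀ y, φ (x, y) = φb x + C ∧ pd1 φ (x, y) = u x} with hS
  have hcφb : ContinuousOn φb (Icc 0 1) := fun t ht => (B.potential t ht).continuousWithinAt
  have hline : ∀ {f : ℝ × ℝ → ℝ}, ContinuousOn f nozzle → ∀ y,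
      ContinuousOn (fun x => f (x, y)) (Icc 0 1) := fun hf y =>
    hf.comp (by fun_prop) fun x hx => mem_nozzle.2 hx
  have hclosed : IsClosed (S ∩ Icc 0 1) := by
    have : S ∩ Icc 0 1 = ⋂ y : ℝ, ((Icc 0 1 ∩ {x | φ (x, y) = φb x + C}) ∩
        (Icc 0 1 ∩ {x | pd1 φ (x, y) = u x})) := by
      ext x
      simp only [hS, mem_inter_iff, mem_ofPred_eq, mem_iInter]
      exact ⟨fun h y => ⟨⟨h.2, (h.1 y).1⟩, h.2, (h.1 y).2⟩,
        fun h => ⟨fun y => ⟨(h y).1.2, (h y).2.2⟩, (h 0).1.1⟩⟩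
    rw [this]
    refine isClosed_iInter fun y => IsClosed.inter ?_ ?_
    · exact isClosed_Icc.isClosed_eq (hline F.contDiffOn.continuousOn y)
        (hcφb.add continuousOn_const)
    · exact isClosed_Icc.isClosed_eq (hline F.contDiffOn_fst.continuousOn y) B.continuousOn
  have hmem0 : (0:ℝ) ∈ S := fun y => by
    refine ⟨?_, hu0 ▸ (F.entry_normal y).2⟩
    have hd : ∀ t, HasDerivAt (fun t => φ (0, t)) 0 t := fun t => by
      simpa only [(F.entry_normal t).1] using hasDerivAt_slice_snd F.diff h0I t
    have := is_const_of_deriv_eq_zero (fun t => (hd t).differentiableAt)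
      (fun t => (hd t).deriv) y 0
    rw [this, hC]
    ring
  have hsub : Icc (0:ℝ) 1 ⊆ S := hclosed.Icc_subset_of_forall_mem_nhdsWithin hmem0
    fun x hx => F.eventually_eq_of_eq B hx.2 (fun y => (hx.1 y).1) fun y => (hx.1 y).2
  refine ⟨C, fun p hp => (hsub (mem_nozzle.1 hp) p.2).1, fun p hp => ⟨?_, ?_⟩⟩
  · refine pd2_eq_of_hasDerivAt F.diff (mem_nozzle.1 hp) ?_
    simpa only [fun y => (hsub (mem_nozzle.1 hp) y).1] using
      hasDerivAt_const p.2 (φb p.1 + C)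
  · exact (hsub (mem_nozzle.1 hp) p.2).2

end SubsonicSonicFlow

end PotentialFlow

/-- Uniqueness of the symmetric subsonic–sonic potential flow in a convergent
approximate nozzle: any `C²` solution of the potential flow equation with the Bernoulli
boundary conditions, inflow/outflow condition `∂₁φ ≥ 0` on the entry and exit, and
acceleration `∂₁₁φ > 0` at the sonic exit coincides with the symmetric solution `φ_b`
modulo a constant. -/
theorem uniqueness_subsonic_sonic_flow
    (γ c₀ : ℝ) (hγ : 1 < γ) (hc₀ : 0 < c₀)
    (n : ℝ → ℝ) (hn : ContDiff ℝ (⊤ : ℕ∞) n)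
    (hnpos : ∀ t ∈ Icc (0:ℝ) 1, 0 < n t)
    (hn'' : ∀ t ∈ Icc (0:ℝ) 1, 0 < deriv (deriv n) t)
    (hn' : ∀ t ∈ Ioo (0:ℝ) 1, deriv n t < 0)
    (hn'1 : deriv n 1 = 0) (hn1 : n 1 = 1)
    (b₁ : ℝ) (hb₁ : b₁ = Real.sqrt (2 * c₀ / (γ + 1)))
    (b₀ : ℝ) (hb₀pos : 0 < b₀) (hb₀lt : b₀ < b₁)
    (hb₀eq : b₀ ^ (γ - 1) * (c₀ - (γ - 1) / 2 * b₀ ^ 2) * (n 0) ^ (γ - 1) = b₁ ^ (γ + 1))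
    -- ρ is the density function
    (ρ : ℝ → ℝ)
    (hρ : ∀ s, 0 ≤ s → s ≤ b₁ → ρ s = ((c₀ - (γ - 1) / 2 * s ^ 2) / γ) ^ (1 / (γ - 1)))
    -- u is the symmetric subsonic–sonic velocity
    (u : ℝ → ℝ) (hu : ContDiffOn ℝ 1 u (Icc 0 1))
    (hu0 : u 0 = b₀) (hu1 : u 1 = b₁)
    (hflux : ∀ x ∈ Icc (0:ℝ) 1, n x * ρ (u x) * u x = n 0 * ρ b₀ * b₀)
    (hu' : ∀ x ∈ Icc (0:ℝ) 1, 0 < derivWithin u (Icc 0 1) x)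
    -- φ_b is the symmetric solution potential, `φ_b' = u`
    (φb : ℝ → ℝ) (hφb : ∀ x ∈ Icc (0:ℝ) 1, HasDerivWithinAt φb (u x) (Icc 0 1) x)
    -- φ is a C² solution of the potential flow problem, 2π-periodic in y
    (φ : ℝ × ℝ → ℝ) (hφ : ContDiffOn ℝ 2 φ nozzle)
    (hper : ∀ x y : ℝ, φ (x, y + 2 * Real.pi) = φ (x, y))
    (hpde : ∀ p ∈ Ioo (0:ℝ) 1 ×ˢ (Set.univ : Set ℝ), PotentialFlowEq γ c₀ n φ p)
    -- the gas flows in at the entry and flows out at the exit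
    (hin : ∀ y : ℝ, 0 ≤ pd1 φ (0, y)) (hout : ∀ y : ℝ, 0 ≤ pd1 φ (1, y))
    -- Bernoulli boundary condition at the entry
    (hentry : ∀ y : ℝ, (pd1 φ (0, y)) ^ 2 + (pd2 φ (0, y)) ^ 2 / (n 0) ^ 2 = b₀ ^ 2)
    -- sonic Bernoulli boundary condition at the exit
    (hexit : ∀ y : ℝ, (pd1 φ (1, y)) ^ 2 + (pd2 φ (1, y)) ^ 2 = b₁ ^ 2)
    -- the flow accelerates at the exit
    (hacc : ∀ y : ℝ, 0 < pd11 φ (1, y)) :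
    ∃ C : ℝ, (∀ p ∈ nozzle, φ p = φb p.1 + C) ∧
      (∀ p ∈ nozzle, pd2 φ p = 0 ∧ pd1 φ p = u p.1) := by

  have hb₁pos : 0 < b₁ := hb₀pos.trans hb₀lt
  have hb₁sq : b₁ ^ 2 = 2 * c₀ / (γ + 1) := by
    rw [hb₁, Real.sq_sqrt (div_nonneg (by linarith) (by linarith))]
  have hsonic : c₀ - (γ - 1) / 2 * b₁ ^ 2 = b₁ ^ 2 := by
    rw [hb₁sq]
    have : γ + 1 ≠ 0 := by linarith
    field_simp
    ring
  have h0I : (0:ℝ) ∈ Icc (0:ℝ) 1 := left_mem_Icc.2 zero_le_one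
  have h1I : (1:ℝ) ∈ Icc (0:ℝ) 1 := right_mem_Icc.2 zero_le_one
  have P : PeriodicFlow γ c₀ n φ := ⟨hγ, hc₀, hn, hnpos, hφ, hper, hpde⟩
  have hbsq : b₀ ^ 2 < b₁ ^ 2 := pow_lt_pow_left₀ hb₀lt hb₀pos.le two_ne_zero
  have hexit' : ∀ y, speedSq n φ (1, y) = b₁ ^ 2 := fun y => by
    simp only [speedSq, hn1, one_pow, div_one, hexit]
  have hantitone : StrictAntiOn n (Icc 0 1) :=
    strictAntiOn_of_deriv_neg (convex_Icc 0 1) hn.continuous.continuousOn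
      (by simpa only [interior_Icc] using hn')
  have hmono : StrictMonoOn u (Icc 0 1) := by
    refine strictMonoOn_of_deriv_pos (convex_Icc 0 1) hu.continuousOn fun x hx => ?_
    rw [← derivWithin_of_mem_nhds (mem_interior_iff_mem_nhds.1 hx)]
    exact hu' x (interior_subset hx)
  have hlb : ∀ x ∈ Icc (0:ℝ) 1, b₀ ≤ u x := fun x hx =>
    hu0 ▸ hmono.monotoneOn h0I hx hx.1
  have hub : ∀ x ∈ Icc (0:ℝ) 1, u x ≤ b₁ := fun x hx =>
    hu1 ▸ hmono.monotoneOn hx h1I hx.2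
  have hρu : ∀ x ∈ Icc (0:ℝ) 1, ρ (u x) = density γ c₀ (u x ^ 2) := fun x hx =>
    hρ _ (hb₀pos.le.trans (hlb x hx)) (hub x hx)
  have hentry' : n 0 * density γ c₀ (b₀ ^ 2) * b₀ = density γ c₀ (b₁ ^ 2) * b₁ := by
    have h1 := hflux 1 h1I
    rw [hρu 1 h1I, hu1, hn1, one_mul, hρ b₀ hb₀pos.le hb₀lt.le] at h1
    exact h1.symm
  have F : SubsonicSonicFlow γ c₀ n b₀ b₁ φ :=
    { P with
      n_one := hn1
      one_lt_n := fun t ht => hn1 ▸ hantitone (Ico_subset_Icc_self ht) h1I ht.2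
      b₀_pos := hb₀pos
      b₀_lt := hb₀lt
      sonic := hsonic
      exit := P.exit_normal hn1 hn'1 hb₁pos hsonic hout hexit hacc
      entry := hentry
      flux_entry := hentry'
      soundSq_pos := fun p hp => P.soundSq_pos (pow_pos hb₁pos 2)
        (fun y => by
          rw [soundSq_eq, show speedSq n φ (0, y) = b₀ ^ 2 from hentry y]
          nlinarith)
        (fun y => by rw [soundSq_eq, hexit', hsonic]) hp }
  have B : AxialFlow γ c₀ n b₁ u φb :=
    { continuousOn := hu.continuousOn
      pos := fun x hx => hb₀pos.trans_le (hlb x hx)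
      subsonic := fun x hx => hu1 ▸ hmono (Ico_subset_Icc_self hx) h1I hx.2
      flux := fun x hx => by
        rw [← hρu x hx, hflux x hx, hρ b₀ hb₀pos.le hb₀lt.le]
        exact hentry'
      potential := hφb }
  exact F.eq_axialFlow B hu0
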